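/- There exists a universal constant C > 0 with the following property. Let ω : ℝ³ → ℝ³ and v : ℝ³ → ℝ³ be Schwartz vector fields satisfying the three-dimensional Biot–Savart relation −Δv = ∇ × ω. Then ‖v‖_{L³(ℝ³)} + ‖∇v‖_{L^{3/2}(ℝ³)} ≤ C ‖∇ × ω‖_{L¹(ℝ³)}. -/

import Mathlib

open MeasureTheory Real
open scoped ENNReal

noncomputable section

/-- Three-dimensional Euclidean space. -/
abbrev E3 := EuclideanSpace ℝ (Fin 3)

/-- Partial derivative of a scalar function in the `i`-th coordinate direction. -/
def pd (i : Fin 3) (f : E3 → ℝ) (x : E3) : ℝ :=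
  fderiv ℝ f x (EuclideanSpace.single i 1)

/-- Componentwise Laplacian of a (possibly vector-valued) function on `ℝ³`. -/
def lap {F : Type*} [NormedAddCommGroup F] [NormedSpace ℝ F] (f : E3 → F) (x : E3) : F :=
  ∑ i : Fin 3, fderiv ℝ (fun y => fderiv ℝ f y (EuclideanSpace.single i 1)) x
    (EuclideanSpace.single i 1)

/-- The curl `∇ × f` of a vector field on `ℝ³`. -/
def curl (f : E3 → E3) (x : E3) : E3 :=
  (EuclideanSpace.equiv (Fin 3) ℝ).symm
    ![pd 1 (fun y => f y 2) x - pd 2 (fun y => f y 1) x,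
      pd 2 (fun y => f y 0) x - pd 0 (fun y => f y 2) x,
      pd 0 (fun y => f y 1) x - pd 1 (fun y => f y 0) x]

open Filter
open scoped LineDeriv SchwartzMap Topology NNReal

/-- The kernel `x_i (|x|² + ε²)^{-3/2}`. -/
def rieszKer (ε : ℝ) (i : Fin 3) (x : E3) : ℝ :=
  x i * (‖x‖ ^ 2 + ε ^ 2) ^ (-(3 / 2) : ℝ)

/-- The partial derivative `∂_k` of `rieszKer ε i`. -/
def rieszKerDeriv (ε : ℝ) (i k : Fin 3) (x : E3) : ℝ :=
  (if i = k then 1 else 0) * (‖x‖ ^ 2 + ε ^ 2) ^ (-(3 / 2) : ℝ) -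
    3 * (x i * x k) * (‖x‖ ^ 2 + ε ^ 2) ^ (-(5 / 2) : ℝ)

lemma abs_coord_le_norm (x : E3) (i : Fin 3) : |x i| ≤ ‖x‖ := by
  simpa using PiLp.norm_apply_le x i

lemma rieszKerDeriv_comm (ε : ℝ) (i k : Fin 3) (x : E3) :
    rieszKerDeriv ε i k x = rieszKerDeriv ε k i x := by
  simp only [rieszKerDeriv, eq_comm, mul_comm (x i)]

lemma norm_sq_add_sq_pos {ε : ℝ} (hε : 0 < ε) (x : E3) : 0 < ‖x‖ ^ 2 + ε ^ 2 := by
  positivity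

lemma hasLineDerivAt_rieszKer {ε : ℝ} (hε : 0 < ε) (i k : Fin 3) (x : E3) :
    HasLineDerivAt ℝ (rieszKer ε i) (rieszKerDeriv ε i k x) x (EuclideanSpace.single k 1) := by
  have h1 : HasFDerivAt (fun y : E3 => ‖y‖ ^ 2 + ε ^ 2) (2 • innerSL ℝ x) x :=
    (hasStrictFDerivAt_norm_sq x).hasFDerivAt.add_const _
  have h2 := h1.rpow_const (p := (-(3 / 2) : ℝ)) (Or.inl (norm_sq_add_sq_pos hε x).ne')
  have h3 : HasFDerivAt (fun y : E3 => y i) (EuclideanSpace.proj i : E3 →L[ℝ] ℝ) x :=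
    (EuclideanSpace.proj i : E3 →L[ℝ] ℝ).hasFDerivAt
  have h4 := (h3.mul h2).hasLineDerivAt (EuclideanSpace.single k 1)
  refine h4.congr_deriv ?_
  simp [rieszKerDeriv, EuclideanSpace.inner_single_right]
  have e : (-(3 / 2) - 1 : ℝ) = -(5 / 2) := by norm_num
  rw [e]
  ring

lemma continuous_rieszKer {ε : ℝ} (hε : 0 < ε) (i : Fin 3) : Continuous (rieszKer ε i) := by
  unfold rieszKer
  refine Continuous.mul (by fun_prop) (Continuous.rpow_const (by fun_prop) fun x => Or.inl ?_)
  exact (norm_sq_add_sq_pos hε x).ne'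

lemma continuous_rieszKerDeriv {ε : ℝ} (hε : 0 < ε) (i k : Fin 3) :
    Continuous (rieszKerDeriv ε i k) := by
  unfold rieszKerDeriv
  refine Continuous.sub (continuous_const.mul ?_) (Continuous.mul (by fun_prop) ?_)
  · exact Continuous.rpow_const (by fun_prop) fun x => Or.inl (norm_sq_add_sq_pos hε x).ne'
  · exact Continuous.rpow_const (by fun_prop) fun x => Or.inl (norm_sq_add_sq_pos hε x).ne'

lemma rpow_neg_three_halves_eq {r : ℝ} (hr : 0 < r) :
    r ^ (-(3 / 2) : ℝ) = r * r ^ (-(5 / 2) : ℝ) := by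
  rw [← Real.rpow_one_add' hr.le (by norm_num)]; norm_num

lemma abs_rieszKerDeriv_le {ε : ℝ} (hε : 0 < ε) (i k : Fin 3) (x : E3) :
    |rieszKerDeriv ε i k x| ≤ 4 * (‖x‖ ^ 2 + ε ^ 2) ^ (-(3 / 2) : ℝ) := by
  have hr := norm_sq_add_sq_pos hε x
  set r := ‖x‖ ^ 2 + ε ^ 2 with hrdef
  have h5 : 0 < r ^ (-(5 / 2) : ℝ) := Real.rpow_pos_of_pos hr _
  have h3 := rpow_neg_three_halves_eq hr
  have hxx : |x i * x k| ≤ r := by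
    rw [abs_mul]
    calc |x i| * |x k| ≤ ‖x‖ * ‖x‖ := by
          gcongr <;> exact abs_coord_le_norm _ _
      _ ≤ r := by rw [hrdef]; nlinarith [sq_nonneg ε]
  have ha : |(if i = k then (1 : ℝ) else 0)| ≤ 1 := by split_ifs <;> simp
  unfold rieszKerDeriv
  rw [← hrdef]
  calc _ ≤ |(if i = k then (1 : ℝ) else 0) * r ^ (-(3 / 2) : ℝ)|
        + |3 * (x i * x k) * r ^ (-(5 / 2) : ℝ)| := abs_sub _ _
    _ ≤ 1 * r ^ (-(3 / 2) : ℝ) + 3 * r * r ^ (-(5 / 2) : ℝ) := by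
        rw [abs_mul, abs_mul, abs_mul, abs_of_pos h5, abs_of_pos (Real.rpow_pos_of_pos hr _)]
        gcongr
        simp
    _ = _ := by rw [h3]; ring

lemma rpow_norm_sq_add_sq_le {ε : ℝ} (hε : 0 < ε) (x : E3) {p : ℝ} (hp : 0 ≤ p) :
    (‖x‖ ^ 2 + ε ^ 2) ^ (-p) ≤ (ε ^ 2) ^ (-p) :=
  Real.rpow_le_rpow_of_nonpos (by positivity) (by nlinarith [sq_nonneg ‖x‖]) (by linarith)

lemma abs_rieszKer_le {ε : ℝ} (hε : 0 < ε) (i : Fin 3) (x : E3) :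
    |rieszKer ε i x| ≤ (ε ^ 2) ^ (-1 : ℝ) := by
  have hr := norm_sq_add_sq_pos hε x
  refine le_trans ?_ (rpow_norm_sq_add_sq_le hε x zero_le_one)
  unfold rieszKer
  set r := ‖x‖ ^ 2 + ε ^ 2 with hrdef
  rw [abs_mul, abs_of_pos (Real.rpow_pos_of_pos hr _)]
  have h1 : |x i| ≤ r ^ (1 / 2 : ℝ) := by
    refine (abs_coord_le_norm x i).trans ?_
    rw [← Real.sqrt_eq_rpow]
    exact Real.le_sqrt_of_sq_le (by rw [hrdef]; nlinarith [sq_nonneg ε])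
  calc |x i| * r ^ (-(3 / 2) : ℝ) ≤ r ^ (1 / 2 : ℝ) * r ^ (-(3 / 2) : ℝ) := by gcongr
    _ = r ^ (-1 : ℝ) := by rw [← Real.rpow_add hr]; norm_num

lemma sum_rieszKerDeriv {ε : ℝ} (hε : 0 < ε) (x : E3) :
    ∑ k, rieszKerDeriv ε k k x = 3 * ε ^ 2 * (‖x‖ ^ 2 + ε ^ 2) ^ (-(5 / 2) : ℝ) := by
  have hr := norm_sq_add_sq_pos hε x
  have hn : ‖x‖ ^ 2 = x 0 ^ 2 + x 1 ^ 2 + x 2 ^ 2 := by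
    rw [EuclideanSpace.norm_sq_eq]; simp [Fin.sum_univ_three]
  simp only [Fin.sum_univ_three, rieszKerDeriv, rpow_neg_three_halves_eq hr, if_true]
  rw [hn]; ring

lemma rpow_neg_eq_inv_pow {a : ℝ} (ha : 0 ≤ a) (n : ℕ) :
    (a ^ 2) ^ (-(n / 2) : ℝ) = (a ^ n)⁻¹ := by
  rw [Real.rpow_neg (by positivity), ← Real.rpow_natCast a 2, ← Real.rpow_mul ha,
    ← Real.rpow_natCast a n]
  congr 2
  push_cast; ring

lemma norm_sq_add_sq_rpow_le {ε : ℝ} (hε : 0 < ε) {x : E3} (hx : x ≠ 0) :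
    (‖x‖ ^ 2 + ε ^ 2) ^ (-(3 / 2) : ℝ) ≤ ε⁻¹ * min ((‖x‖ ^ 2)⁻¹) (ε * (‖x‖ ^ 3)⁻¹) := by
  have hρ : 0 < ‖x‖ := norm_pos_iff.2 hx
  have hr := norm_sq_add_sq_pos hε x
  rw [mul_min_of_nonneg _ _ (inv_nonneg.2 hε.le), inv_mul_cancel_left₀ hε.ne']
  refine le_min ?_ ?_
  · have e : (-(3 / 2) : ℝ) = -((1 : ℕ) / 2) + -((2 : ℕ) / 2) := by norm_num
    rw [e, Real.rpow_add hr]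
    gcongr
    · rw [show ε⁻¹ = (ε ^ 1)⁻¹ by simp, ← rpow_neg_eq_inv_pow hε.le 1]
      exact Real.rpow_le_rpow_of_nonpos (by positivity) (by nlinarith) (by norm_num)
    · rw [← rpow_neg_eq_inv_pow hρ.le 2]
      exact Real.rpow_le_rpow_of_nonpos (by positivity) (by nlinarith) (by norm_num)
  · have := rpow_neg_eq_inv_pow hρ.le 3
    norm_num at this
    rw [← this]
    exact Real.rpow_le_rpow_of_nonpos (by positivity) (by nlinarith) (by norm_num)

lemma abs_rieszKer_sub_le {δ ε : ℝ} (hδ : 0 < δ) (h : δ ≤ ε) (i : Fin 3) {x : E3} (hx : x ≠ 0) :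
    |rieszKer δ i x - rieszKer ε i x| ≤ 3 * min ((‖x‖ ^ 2)⁻¹) (ε * (‖x‖ ^ 3)⁻¹) := by
  have hε : 0 < ε := hδ.trans_le h
  have hρ : 0 < ‖x‖ := norm_pos_iff.2 hx
  set ρ := ‖x‖ with hρdef
  set s := √(ρ ^ 2 + ε ^ 2) with hs
  have hs2 : s ^ 2 = ρ ^ 2 + ε ^ 2 := Real.sq_sqrt (by positivity)
  have hs0 : 0 < s := Real.sqrt_pos.2 (by positivity)
  have hρs : ρ ≤ s := Real.le_sqrt_of_sq_le (by nlinarith)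
  have hsε : s - ρ ≤ ε := by
    by_contra! hc
    nlinarith
  have e3 : ∀ a : ℝ, 0 ≤ a → (a ^ 2) ^ (-(3 / 2) : ℝ) = (a ^ 3)⁻¹ := fun a ha => by
    simpa using rpow_neg_eq_inv_pow ha 3
  have k1 : (ρ ^ 2 + ε ^ 2) ^ (-(3 / 2) : ℝ) = (s ^ 3)⁻¹ := by rw [← hs2, e3 s hs0.le]
  have k2 : (ρ ^ 2 + δ ^ 2) ^ (-(3 / 2) : ℝ) ≤ (ρ ^ 3)⁻¹ := by
    rw [← e3 ρ hρ.le]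
    exact Real.rpow_le_rpow_of_nonpos (by positivity) (by nlinarith) (by norm_num)
  have k3 : (ρ ^ 2 + ε ^ 2) ^ (-(3 / 2) : ℝ) ≤ (ρ ^ 2 + δ ^ 2) ^ (-(3 / 2) : ℝ) :=
    Real.rpow_le_rpow_of_nonpos (by positivity) (by nlinarith) (by norm_num)
  have k4 : |rieszKer δ i x - rieszKer ε i x| ≤ ρ * ((ρ ^ 3)⁻¹ - (s ^ 3)⁻¹) := by
    unfold rieszKer
    rw [← hρdef, ← mul_sub, abs_mul, abs_of_nonneg (sub_nonneg.2 k3)]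
    have := abs_coord_le_norm x i
    have hnn := sub_nonneg.2 k3
    rw [k1] at hnn ⊢
    gcongr
  refine k4.trans ?_
  rw [mul_min_of_nonneg _ _ (by norm_num)]
  refine le_min ?_ ?_
  · have : ρ * ((ρ ^ 3)⁻¹ - (s ^ 3)⁻¹) ≤ ρ * (ρ ^ 3)⁻¹ := by
      gcongr; simp; positivity
    refine this.trans ?_
    have : ρ * (ρ ^ 3)⁻¹ = (ρ ^ 2)⁻¹ := by field_simp
    rw [this]
    have : 0 < (ρ ^ 2)⁻¹ := by positivity
    linarith
  · have e : ρ * ((ρ ^ 3)⁻¹ - (s ^ 3)⁻¹) = (s - ρ) * (s ^ 2 + s * ρ + ρ ^ 2) / (ρ ^ 2 * s ^ 3) := by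
      field_simp; ring
    have e' : 3 * (ε * (ρ ^ 3)⁻¹) = 3 * ε / ρ ^ 3 := by ring
    rw [e, e', div_le_div_iff₀ (by positivity) (by positivity)]
    have a1 : s ^ 2 + s * ρ + ρ ^ 2 ≤ 3 * s ^ 2 := by nlinarith
    have hsρ : 0 ≤ s - ρ := by linarith
    calc (s - ρ) * (s ^ 2 + s * ρ + ρ ^ 2) * ρ ^ 3 ≤ ε * (3 * s ^ 2) * (ρ ^ 2 * s) := by
          gcongr
          calc ρ ^ 3 = ρ ^ 2 * ρ := by ring
            _ ≤ ρ ^ 2 * s := by gcongr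
      _ = _ := by ring

/-- The partial derivative of a Schwartz function, as a Schwartz function. -/
def coordDeriv (k : Fin 3) (u : 𝓢(E3, ℝ)) : 𝓢(E3, ℝ) :=
  ∂_{EuclideanSpace.single k (1 : ℝ)} u

lemma coordDeriv_apply (k : Fin 3) (u : 𝓢(E3, ℝ)) (x : E3) :
    coordDeriv k u x = fderiv ℝ u x (EuclideanSpace.single k 1) :=
  SchwartzMap.lineDerivOp_apply_eq_fderiv _ _ _

lemma integrable_schwartz_bdd_mul (u : 𝓢(E3, ℝ)) {k : E3 → ℝ} (hk : Continuous k) {C : ℝ}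
    (hC : ∀ y, |k y| ≤ C) : Integrable (fun y => k y * u y) :=
  u.integrable.bdd_mul hk.aestronglyMeasurable (ae_of_all _ hC)

lemma abs_rieszKerDeriv_le_const {ε : ℝ} (hε : 0 < ε) (i k : Fin 3) (x : E3) :
    |rieszKerDeriv ε i k x| ≤ 4 * (ε ^ 2) ^ (-(3 / 2) : ℝ) :=
  (abs_rieszKerDeriv_le hε i k x).trans
    (mul_le_mul_of_nonneg_left (rpow_norm_sq_add_sq_le hε x (by norm_num)) (by norm_num))

lemma integrable_rieszKer_mul {ε : ℝ} (hε : 0 < ε) (i : Fin 3) (u : 𝓢(E3, ℝ)) (x : E3) :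
    Integrable (fun y => rieszKer ε i (x - y) * u y) :=
  integrable_schwartz_bdd_mul u ((continuous_rieszKer hε i).comp (by fun_prop))
    fun _ => abs_rieszKer_le hε i _

lemma integrable_rieszKerDeriv_mul {ε : ℝ} (hε : 0 < ε) (i k : Fin 3) (u : 𝓢(E3, ℝ)) (x : E3) :
    Integrable (fun y => rieszKerDeriv ε i k (x - y) * u y) :=
  integrable_schwartz_bdd_mul u ((continuous_rieszKerDeriv hε i k).comp (by fun_prop))
    fun _ => abs_rieszKerDeriv_le_const hε i k _

lemma hasLineDerivAt_coordDeriv (k : Fin 3) (u : 𝓢(E3, ℝ)) (x : E3) :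
    HasLineDerivAt ℝ u (coordDeriv k u x) x (EuclideanSpace.single k 1) := by
  rw [coordDeriv_apply]
  exact (u.hasFDerivAt x).hasLineDerivAt _

/-- Chain rule for `y ↦ f (x - y)`. -/
lemma HasLineDerivAt.comp_const_sub {E : Type*} [AddCommGroup E] [Module ℝ E]
    {f : E → ℝ} {f' : ℝ} {x y m : E}
    (h : HasLineDerivAt ℝ f f' (x - y) m) : HasLineDerivAt ℝ (fun z => f (x - z)) (-f') y m := by
  have h1 : HasDerivAt (fun t : ℝ => f (x - y + t • m)) f' (-0) := by rw [neg_zero]; exact h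
  have h2 := h1.scomp (0 : ℝ) (hasDerivAt_neg' (0 : ℝ))
  simp only [smul_eq_mul, neg_mul, one_mul] at h2
  refine h2.congr_of_eventuallyEq (Eventually.of_forall fun t => ?_)
  simp only [Function.comp, neg_smul]
  congr 1; abel

lemma integral_rieszKer_mul_lineDeriv {ε : ℝ} (hε : 0 < ε) (i k : Fin 3) (u : 𝓢(E3, ℝ)) (x : E3) :
    ∫ y, rieszKer ε i (x - y) * coordDeriv k u y =
      ∫ y, rieszKerDeriv ε i k (x - y) * u y := by
  have h := integral_bilinear_hasLineDerivAt_right_eq_neg_left_of_integrable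
    (μ := (volume : Measure E3)) (B := ContinuousLinearMap.mul ℝ ℝ)
    (f := fun y => rieszKer ε i (x - y)) (f' := fun y => -rieszKerDeriv ε i k (x - y))
    (g := u) (g' := coordDeriv k u)
    (v := EuclideanSpace.single k (1 : ℝ))
    (by simpa using (integrable_rieszKerDeriv_mul hε i k u x).neg)
    (by simpa using integrable_rieszKer_mul hε i _ x)
    (by simpa using integrable_rieszKer_mul hε i u x)
    (fun y _ => (hasLineDerivAt_rieszKer hε i k (x - y)).comp_const_sub)
    (fun y _ => hasLineDerivAt_coordDeriv k u y)
  simpa [integral_neg] using h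

lemma coordDeriv_comm (v : 𝓢(E3, ℝ)) (m n : Fin 3) :
    coordDeriv m (coordDeriv n v) = coordDeriv n (coordDeriv m v) := by
  ext x
  have key : ∀ a b : Fin 3, coordDeriv a (coordDeriv b v) x =
      fderiv ℝ (fderiv ℝ v) x (EuclideanSpace.single a 1) (EuclideanSpace.single b 1) := by
    intro a b
    have : (⇑(coordDeriv b v) : E3 → ℝ) = fun y => fderiv ℝ v y (EuclideanSpace.single b 1) := by
      ext y; rw [coordDeriv_apply]
    rw [coordDeriv_apply, this,
      fderiv_clm_apply (((v.smooth 2).fderiv_right (m := 1) (by norm_num)).differentiable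
      (by norm_num) x) (differentiableAt_const _)]
    simp
  rw [key, key]
  exact ((v.smooth 2).contDiffAt.isSymmSndFDerivAt (by simp)) _ _

/-- The regularised Poisson-type kernel `3 ε² (|x|² + ε²)^{-5/2}`. -/
def approxDelta (ε : ℝ) (x : E3) : ℝ := 3 * ε ^ 2 * (‖x‖ ^ 2 + ε ^ 2) ^ (-(5 / 2) : ℝ)

lemma integral_rieszKer_mul_laplacian {ε : ℝ} (hε : 0 < ε) (i : Fin 3) (v : 𝓢(E3, ℝ)) (x : E3) :
    ∫ y, rieszKer ε i (x - y) * (∑ k : Fin 3, coordDeriv k (coordDeriv k v) y) =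
      ∫ y, approxDelta ε (x - y) * coordDeriv i v y := by
  have h : ∀ k : Fin 3, ∫ y, rieszKer ε i (x - y) * coordDeriv k (coordDeriv k v) y =
      ∫ y, rieszKerDeriv ε k k (x - y) * coordDeriv i v y := by
    intro k
    rw [integral_rieszKer_mul_lineDeriv hε]
    simp_rw [rieszKerDeriv_comm ε i k]
    rw [← integral_rieszKer_mul_lineDeriv hε, coordDeriv_comm v i k,
      integral_rieszKer_mul_lineDeriv hε]
  simp_rw [Finset.mul_sum]
  rw [integral_finsetSum _ fun k _ => integrable_rieszKer_mul hε i _ x]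
  simp_rw [h]
  rw [← integral_finsetSum _ fun k _ => integrable_rieszKerDeriv_mul hε k k _ x]
  refine integral_congr_ae (ae_of_all _ fun y => ?_)
  simp only
  rw [← Finset.sum_mul, sum_rieszKerDeriv hε]
  rfl

lemma approxDelta_smul {ε : ℝ} (hε : 0 < ε) (x : E3) :
    ε ^ 3 * approxDelta ε (ε • x) = approxDelta 1 x := by
  unfold approxDelta
  have : ‖ε • x‖ ^ 2 + ε ^ 2 = ε ^ 2 * (‖x‖ ^ 2 + 1 ^ 2) := by
    rw [norm_smul, Real.norm_of_nonneg hε.le]; ring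
  rw [this, Real.mul_rpow (by positivity) (by positivity)]
  have := rpow_neg_eq_inv_pow hε.le 5
  norm_num at this
  norm_num
  rw [this]
  field_simp

lemma integrable_approxDelta_one : Integrable (approxDelta 1) := by
  have := integrable_rpow_neg_one_add_norm_sq (E := E3) (μ := volume) (r := 5) (by norm_num)
  refine (this.const_mul 3).congr (ae_of_all _ fun x => ?_)
  simp only [approxDelta]
  norm_num
  rw [add_comm]

lemma continuous_approxDelta {ε : ℝ} (hε : 0 < ε) : Continuous (approxDelta ε) := by
  unfold approxDelta
  exact continuous_const.mul (Continuous.rpow_const (by fun_prop) fun x =>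
    Or.inl (norm_sq_add_sq_pos hε x).ne')

lemma approxDelta_pos {ε : ℝ} (hε : 0 < ε) (x : E3) : 0 < approxDelta ε x :=
  mul_pos (by positivity) (Real.rpow_pos_of_pos (norm_sq_add_sq_pos hε x) _)

lemma integral_approxDelta_one_pos : 0 < ∫ x, approxDelta 1 x :=
  integral_pos_of_integrable_nonneg_nonzero (x := 0) (continuous_approxDelta one_pos)
    integrable_approxDelta_one (fun x => (approxDelta_pos one_pos x).le)
    (approxDelta_pos one_pos 0).ne'

lemma integral_approxDelta_mul {ε : ℝ} (hε : 0 < ε) (h : E3 → ℝ) (x : E3) :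
    ∫ y, approxDelta ε (x - y) * h y = ∫ z, approxDelta 1 z * h (x - ε • z) := by
  have h1 : ∫ y, approxDelta ε (x - y) * h y = ∫ y, approxDelta ε y * h (x - y) := by
    rw [← integral_sub_left_eq_self (fun y => approxDelta ε y * h (x - y)) volume x]
    simp
  have h2 := Measure.integral_comp_smul (volume : Measure E3)
    (fun y => approxDelta ε y * h (x - y)) ε
  rw [h1]
  simp_rw [← approxDelta_smul hε, mul_assoc]
  rw [integral_const_mul, h2]
  have : (0:ℝ) < ε ^ 3 := by positivity
  simp [abs_of_pos (inv_pos.2 this)]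
  field_simp

lemma tendsto_integral_approxDelta (h : 𝓢(E3, ℝ)) (x : E3) :
    Tendsto (fun ε : ℝ => ∫ z, approxDelta 1 z * h (x - ε • z)) (𝓝[>] 0)
      (𝓝 ((∫ z, approxDelta 1 z) * h x)) := by
  rw [← integral_mul_const]
  refine tendsto_integral_filter_of_dominated_convergence
    (fun z => approxDelta 1 z * SchwartzMap.seminorm ℝ 0 0 h) ?_ ?_ ?_ ?_
  · refine Eventually.of_forall fun ε => Continuous.aestronglyMeasurable ?_
    exact (continuous_approxDelta one_pos).mul (h.continuous.comp (by fun_prop))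
  · refine Eventually.of_forall fun ε => ae_of_all _ fun z => ?_
    rw [norm_mul, Real.norm_of_nonneg (approxDelta_pos one_pos z).le]
    have := approxDelta_pos one_pos z
    gcongr
    exact h.norm_le_seminorm ℝ _
  · exact integrable_approxDelta_one.mul_const _
  · refine ae_of_all _ fun z => ?_
    refine Tendsto.const_mul _ ?_
    have : Tendsto (fun ε : ℝ => h (x - ε • z)) (𝓝 0) (𝓝 (h (x - (0:ℝ) • z))) :=
      (h.continuous.comp (by fun_prop : Continuous fun ε : ℝ => x - ε • z)).tendsto 0
    simpa using this.mono_left nhdsWithin_le_nhds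

/-- Convolving the regularised kernels with `Δ v` recovers `∂_i v` up to a constant. -/
lemma tendsto_integral_rieszKer_laplacian (i : Fin 3) (v : 𝓢(E3, ℝ)) {ψ : E3 → ℝ}
    (hψ : Integrable ψ) :
    Tendsto (fun ε : ℝ => ∫ x, ψ x * ∫ y, rieszKer ε i (x - y) *
      (∑ k : Fin 3, coordDeriv k (coordDeriv k v) y)) (𝓝[>] 0)
      (𝓝 ((∫ z, approxDelta 1 z) *
        ∫ x, ψ x * coordDeriv i v x)) := by
  set h := coordDeriv i v
  have e : ∀ᶠ ε : ℝ in 𝓝[>] 0, ∫ x, ψ x * ∫ z, approxDelta 1 z * h (x - ε • z) =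
      ∫ x, ψ x * ∫ y, rieszKer ε i (x - y) *
      (∑ k : Fin 3, coordDeriv k (coordDeriv k v) y) := by
    filter_upwards [self_mem_nhdsWithin] with ε (hε : 0 < ε)
    simp_rw [integral_rieszKer_mul_laplacian hε, integral_approxDelta_mul hε]
    rfl
  refine Tendsto.congr' e ?_
  rw [← integral_const_mul]
  refine tendsto_integral_filter_of_dominated_convergence
    (fun x => ‖ψ x‖ * ∫ z, approxDelta 1 z * SchwartzMap.seminorm ℝ 0 0 h) ?_ ?_ ?_ ?_
  · refine Eventually.of_forall fun ε => hψ.aestronglyMeasurable.mul ?_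
    refine (StronglyMeasurable.integral_prod_right
      (f := fun x z => approxDelta 1 z * h (x - ε • z)) ?_).aestronglyMeasurable
    refine Continuous.stronglyMeasurable ?_
    exact ((continuous_approxDelta one_pos).comp continuous_snd).mul
      (h.continuous.comp (by fun_prop))
  · refine Eventually.of_forall fun ε => ae_of_all _ fun x => ?_
    rw [norm_mul]
    gcongr
    refine norm_integral_le_of_norm_le (integrable_approxDelta_one.mul_const _)
      (ae_of_all _ fun z => ?_)
    rw [norm_mul, Real.norm_of_nonneg (approxDelta_pos one_pos z).le]
    have := approxDelta_pos one_pos z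
    gcongr
    exact h.norm_le_seminorm ℝ _
  · exact hψ.norm.mul_const _
  · refine ae_of_all _ fun x => ?_
    have := (tendsto_integral_approxDelta h x).const_mul (ψ x)
    refine this.trans_eq ?_
    congr 1; ring

/-- Inserting `t` as the `j`-th coordinate identifies `ℝ × ℝ²` with `ℝ³`. -/
def insCoord (j : Fin 3) : ℝ × (Fin 2 → ℝ) ≃ᵐ E3 :=
  (MeasurableEquiv.piFinSuccAbove (fun _ : Fin 3 => ℝ) j).symm.trans
    (MeasurableEquiv.toLp 2 (Fin 3 → ℝ))

lemma insCoord_eq (j : Fin 3) (p : ℝ × (Fin 2 → ℝ)) :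
    insCoord j p = WithLp.toLp 2 (j.insertNth p.1 p.2) := rfl

@[simp] lemma insCoord_apply_same (j : Fin 3) (p : ℝ × (Fin 2 → ℝ)) : insCoord j p j = p.1 := by
  simp [insCoord_eq]

@[simp] lemma insCoord_apply_succAbove (j : Fin 3) (p : ℝ × (Fin 2 → ℝ)) (k : Fin 2) :
    insCoord j p (j.succAbove k) = p.2 k := by
  simp [insCoord_eq]

lemma measurePreserving_insCoord (j : Fin 3) : MeasurePreserving (insCoord j) :=
  (volume_preserving_piFinSuccAbove (fun _ : Fin 3 => ℝ) j).symm.trans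
    (PiLp.volume_preserving_toLp (Fin 3))

lemma E3_ext_succAbove (j : Fin 3) {x y : E3} (h : x j = y j)
    (h' : ∀ k, x (j.succAbove k) = y (j.succAbove k)) : x = y := by
  ext i
  rcases Fin.eq_self_or_eq_succAbove j i with rfl | ⟨k, rfl⟩
  exacts [h, h' k]

lemma continuous_insCoord (j : Fin 3) : Continuous (insCoord j) := by
  refine (PiLp.continuous_toLp 2 (fun _ : Fin 3 => ℝ)).comp ?_
  refine continuous_pi fun i => ?_
  rcases Fin.eq_self_or_eq_succAbove j i with rfl | ⟨k, rfl⟩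
  · simpa using continuous_fst
  · have h : Continuous fun a : ℝ × (Fin 2 → ℝ) => a.2 k := by fun_prop
    simpa using h

lemma insCoord_sub (j : Fin 3) (p q : ℝ × (Fin 2 → ℝ)) :
    insCoord j p - insCoord j q = insCoord j (p - q) :=
  E3_ext_succAbove j (by simp) (by simp)

lemma norm_sq_insCoord (j : Fin 3) (p : ℝ × (Fin 2 → ℝ)) :
    ‖insCoord j p‖ ^ 2 = p.1 ^ 2 + ∑ k, p.2 k ^ 2 := by
  rw [EuclideanSpace.norm_sq_eq, Fin.sum_univ_succAbove _ j]
  simp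

lemma insCoord_add_smul_single (j : Fin 3) (t r : ℝ) (z : Fin 2 → ℝ) (k : Fin 2) :
    insCoord j (t, z + r • Pi.single k 1) =
      insCoord j (t, z) + r • EuclideanSpace.single (j.succAbove k) 1 :=
  E3_ext_succAbove j (by simp) (by
    intro l; simp [Pi.single_apply, (Fin.succAbove_right_injective (p := j)).eq_iff])

lemma insCoord_add_fst (j : Fin 3) (t r : ℝ) (z : Fin 2 → ℝ) :
    insCoord j (t + r, z) = insCoord j (t, z) + r • EuclideanSpace.single j 1 :=
  E3_ext_succAbove j (by simp) (by simp)

lemma hasLineDerivAt_slice (u : 𝓢(E3, ℝ)) (j : Fin 3) (t : ℝ) (k : Fin 2) (z : Fin 2 → ℝ) :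
    HasLineDerivAt ℝ (fun w => u (insCoord j (t, w)))
      (coordDeriv (j.succAbove k) u (insCoord j (t, z))) z (Pi.single k 1) := by
  have := hasLineDerivAt_coordDeriv (j.succAbove k) u (insCoord j (t, z))
  unfold HasLineDerivAt at this ⊢
  simpa only [insCoord_add_smul_single] using this

lemma hasDerivAt_fiber (u : 𝓢(E3, ℝ)) (j : Fin 3) (t : ℝ) (z : Fin 2 → ℝ) :
    HasDerivAt (fun s => u (insCoord j (s, z))) (coordDeriv j u (insCoord j (t, z))) t := by
  have h : HasDerivAt (fun r : ℝ => u (insCoord j (t, z) + r • EuclideanSpace.single j 1))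
    (coordDeriv j u (insCoord j (t, z))) (t - t) := by
    rw [sub_self]; exact hasLineDerivAt_coordDeriv j u (insCoord j (t, z))
  have h2 := h.comp_sub_const t t
  simp only [← insCoord_add_fst] at h2
  simpa using h2

lemma integrable_comp_insCoord (j : Fin 3) {u : E3 → ℝ} (hu : Integrable u) :
    Integrable (fun p : ℝ × (Fin 2 → ℝ) => u (insCoord j p)) :=
  ((measurePreserving_insCoord j).integrable_comp_emb (insCoord j).measurableEmbedding).2 hu

lemma integrable_insCoord_mul (j : Fin 3) (u : 𝓢(E3, ℝ)) {χ : (Fin 2 → ℝ) → ℝ} {C : ℝ}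
    (hχ : Continuous χ) (hC : ∀ z, |χ z| ≤ C) :
    Integrable (fun p : ℝ × (Fin 2 → ℝ) => u (insCoord j p) * χ p.2) :=
  (integrable_comp_insCoord j u.integrable).mul_bdd
    (hχ.comp continuous_snd).aestronglyMeasurable (ae_of_all _ fun p => hC p.2)

lemma schwartz_eq_integral_Iic (u : 𝓢(E3, ℝ)) (j : Fin 3) (t : ℝ) {z : Fin 2 → ℝ}
    (h : Integrable (fun s => u (insCoord j (s, z))))
    (h' : Integrable (fun s => coordDeriv j u (insCoord j (s, z)))) :
    u (insCoord j (t, z)) = ∫ s in Set.Iic t, coordDeriv j u (insCoord j (s, z)) := by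
  have hd : ∀ s ∈ Set.Iic t, HasDerivAt (fun s => u (insCoord j (s, z)))
      (coordDeriv j u (insCoord j (s, z))) s := fun s _ => hasDerivAt_fiber u j s z
  rw [integral_Iic_of_hasDerivAt_of_tendsto' hd h'.integrableOn
    (tendsto_zero_of_hasDerivAt_of_integrableOn_Iic hd h'.integrableOn h.integrableOn), sub_zero]

/-- For a divergence-free field, the integral of the normal component over a slice against a
function of the tangential variables is controlled by the tangential derivatives of that
function. -/
lemma enorm_integral_slice_le (f : Fin 3 → 𝓢(E3, ℝ)) (hdiv : ∀ x, ∑ k, coordDeriv k (f k) x = 0)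
    (j : Fin 3) (t : ℝ) {χ : (Fin 2 → ℝ) → ℝ} {χ' : Fin 2 → (Fin 2 → ℝ) → ℝ} {C C' : ℝ}
    (hχ : Continuous χ) (hC : ∀ z, |χ z| ≤ C) (hχ' : ∀ k, Continuous (χ' k))
    (hC' : ∀ k z, |χ' k z| ≤ C') (hd : ∀ k z, HasLineDerivAt ℝ χ (χ' k z) z (Pi.single k 1)) :
    ‖∫ z, f j (insCoord j (t, z)) * χ z‖ₑ ≤
      ∫⁻ s, ∫⁻ z, ∑ k : Fin 2, ‖f (j.succAbove k) (insCoord j (s, z))‖ₑ * ‖χ' k z‖ₑ := by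
  have hI : ∀ u : 𝓢(E3, ℝ), Integrable (fun p : ℝ × (Fin 2 → ℝ) => u (insCoord j p) * χ p.2) :=
    fun u => integrable_insCoord_mul j u hχ hC
  have hI' : ∀ (u : 𝓢(E3, ℝ)) k,
      Integrable (fun p : ℝ × (Fin 2 → ℝ) => u (insCoord j p) * χ' k p.2) :=
    fun u k => integrable_insCoord_mul j u (hχ' k) (hC' k)
  have hs : ∀ u : 𝓢(E3, ℝ), ∀ᵐ z : Fin 2 → ℝ, Integrable (fun s => u (insCoord j (s, z))) :=
    fun u => (integrable_comp_insCoord j u.integrable).prod_left_ae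
  have e1 : ∫ z, f j (insCoord j (t, z)) * χ z =
      ∫ z, ∫ s in Set.Iic t, coordDeriv j (f j) (insCoord j (s, z)) * χ z := by
    refine integral_congr_ae ?_
    filter_upwards [hs (f j), hs (coordDeriv j (f j))] with z h1 h2
    rw [integral_mul_const, schwartz_eq_integral_Iic (f j) j t h1 h2]
  have hres : Integrable (fun p : ℝ × (Fin 2 → ℝ) =>
      coordDeriv j (f j) (insCoord j p) * χ p.2)
      ((volume.restrict (Set.Iic t)).prod volume) := by
    have := (hI (coordDeriv j (f j))).restrict (s := Set.Iic t ×ˢ Set.univ)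
    rwa [Measure.volume_eq_prod, ← Measure.prod_restrict, Measure.restrict_univ] at this
  rw [e1, ← integral_integral_swap (f := fun s z => coordDeriv j (f j) (insCoord j (s, z)) * χ z)
    hres]
  refine (enorm_integral_le_lintegral_enorm _).trans ?_
  refine (lintegral_mono' Measure.restrict_le_self le_rfl).trans ?_
  refine lintegral_mono_ae ?_
  have hall : ∀ k : Fin 2, ∀ᵐ s : ℝ,
      Integrable (fun z => f (j.succAbove k) (insCoord j (s, z)) * χ z) ∧
      Integrable (fun z => f (j.succAbove k) (insCoord j (s, z)) * χ' k z) ∧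
      Integrable (fun z => coordDeriv (j.succAbove k) (f (j.succAbove k))
        (insCoord j (s, z)) * χ z) := fun k => by
    filter_upwards [(hI (f (j.succAbove k))).prod_right_ae,
      (hI' (f (j.succAbove k)) k).prod_right_ae,
      (hI (coordDeriv (j.succAbove k) (f (j.succAbove k)))).prod_right_ae] with s h1 h2 h3
    exact ⟨h1, h2, h3⟩
  filter_upwards [ae_all_iff.2 hall] with s hfi
  have e2 : ∫ z, coordDeriv j (f j) (insCoord j (s, z)) * χ z =
      ∫ z, ∑ k : Fin 2, f (j.succAbove k) (insCoord j (s, z)) * χ' k z := by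
    have : ∀ z, coordDeriv j (f j) (insCoord j (s, z)) * χ z =
        -∑ k : Fin 2, coordDeriv (j.succAbove k) (f (j.succAbove k)) (insCoord j (s, z)) * χ z := by
      intro z
      have := hdiv (insCoord j (s, z))
      rw [Fin.sum_univ_succAbove _ j] at this
      rw [← Finset.sum_mul, ← neg_mul, ← eq_neg_of_add_eq_zero_left this]
    simp_rw [this]
    rw [integral_neg, integral_finsetSum _ fun k _ => (hfi k).2.2,
      integral_finsetSum _ fun k _ => (hfi k).2.1, ← Finset.sum_neg_distrib]
    refine Finset.sum_congr rfl fun k _ => ?_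
    have h := integral_bilinear_hasLineDerivAt_right_eq_neg_left_of_integrable
      (μ := (volume : Measure (Fin 2 → ℝ))) (B := ContinuousLinearMap.mul ℝ ℝ)
      (f := fun z => f (j.succAbove k) (insCoord j (s, z)))
      (f' := fun z => coordDeriv (j.succAbove k) (f (j.succAbove k)) (insCoord j (s, z)))
      (g := χ) (g' := χ' k) (v := Pi.single k 1) (by simpa using (hfi k).2.2)
      (by simpa using (hfi k).2.1) (by simpa using (hfi k).1)
      (fun z _ => hasLineDerivAt_slice _ j s k z) (fun z _ => hd k z)
    simpa using h.symm
  rw [e2]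
  refine (enorm_integral_le_lintegral_enorm _).trans (lintegral_mono fun z => ?_)
  refine (enorm_sum_le _ _).trans (Finset.sum_le_sum fun k _ => ?_)
  rw [enorm_mul]

/-- The Euclidean norm of `(τ, z) ∈ ℝ × ℝ²`. -/
def slabNorm (τ : ℝ) (z : Fin 2 → ℝ) : ℝ := √(τ ^ 2 + ∑ k, z k ^ 2)

/-- The kernel `min (ρ⁻², ε ρ⁻³)` with `ρ = |(τ, z)|`. -/
def minKer (ε τ : ℝ) (z : Fin 2 → ℝ) : ℝ :=
  min ((slabNorm τ z ^ 2)⁻¹) (ε * (slabNorm τ z ^ 3)⁻¹)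

lemma norm_insCoord (j : Fin 3) (τ : ℝ) (z : Fin 2 → ℝ) : ‖insCoord j (τ, z)‖ = slabNorm τ z := by
  rw [slabNorm, ← norm_sq_insCoord j (τ, z), Real.sqrt_sq (norm_nonneg _)]

lemma insCoord_ne_zero (j : Fin 3) {τ : ℝ} (hτ : τ ≠ 0) (z : Fin 2 → ℝ) :
    insCoord j (τ, z) ≠ 0 := fun h => hτ (by simpa using congrArg (fun x : E3 => x j) h)

lemma enorm_integral_slice_rieszKer_le (f : Fin 3 → 𝓢(E3, ℝ))
    (hdiv : ∀ x, ∑ k, coordDeriv k (f k) x = 0) (i j : Fin 3) {η ε s t : ℝ} (hε : 0 < ε)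
    (hη : ε ≤ η) (hst : s - t ≠ 0) (w : Fin 2 → ℝ) :
    ‖∫ z, f j (insCoord j (t, z)) * rieszKer η i (insCoord j (s - t, w - z))‖ₑ ≤
      ENNReal.ofReal (4 * ε⁻¹) * ∫⁻ s', ∫⁻ z,
        (∑ k : Fin 2, ‖f (j.succAbove k) (insCoord j (s', z))‖ₑ) *
          ENNReal.ofReal (minKer ε (s - t) (w - z)) := by
  have hη0 : 0 < η := hε.trans_le hη
  have hcont : Continuous fun z : Fin 2 → ℝ => insCoord j (s - t, w - z) :=
    (continuous_insCoord j).comp (by fun_prop)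
  refine (enorm_integral_slice_le f hdiv j t
    (χ := fun z => rieszKer η i (insCoord j (s - t, w - z)))
    (χ' := fun k z => -rieszKerDeriv η i (j.succAbove k) (insCoord j (s - t, w - z)))
    ((continuous_rieszKer hη0 i).comp hcont) (fun z => abs_rieszKer_le hη0 i _)
    (fun k => ((continuous_rieszKerDeriv hη0 i _).comp hcont).neg)
    (fun k z => (abs_neg _).trans_le (abs_rieszKerDeriv_le_const hη0 i _ _)) ?_).trans ?_
  · intro k z
    refine HasLineDerivAt.comp_const_sub (f := fun z => rieszKer η i (insCoord j (s - t, z))) ?_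
    have := hasLineDerivAt_rieszKer hη0 i (j.succAbove k) (insCoord j (s - t, w - z))
    unfold HasLineDerivAt at this ⊢
    simpa only [insCoord_add_smul_single] using this
  · rw [← lintegral_const_mul' _ _ ENNReal.ofReal_ne_top]
    refine lintegral_mono fun s' => ?_
    rw [← lintegral_const_mul' _ _ ENNReal.ofReal_ne_top]
    refine lintegral_mono fun z => ?_
    simp only
    rw [mul_left_comm, Finset.sum_mul]
    refine Finset.sum_le_sum fun k _ => ?_
    gcongr
    rw [enorm_neg, Real.enorm_eq_ofReal_abs, ← ENNReal.ofReal_mul (by positivity)]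
    refine ENNReal.ofReal_le_ofReal ((abs_rieszKerDeriv_le hη0 _ _ _).trans ?_)
    have hne := insCoord_ne_zero j hst (w - z)
    have h1 := norm_sq_add_sq_rpow_le hε hne
    rw [norm_insCoord] at h1
    have h2 : (slabNorm (s - t) (w - z) ^ 2 + η ^ 2) ^ (-(3 / 2) : ℝ) ≤
        (slabNorm (s - t) (w - z) ^ 2 + ε ^ 2) ^ (-(3 / 2) : ℝ) :=
      Real.rpow_le_rpow_of_nonpos (by positivity) (by gcongr) (by norm_num)
    rw [norm_insCoord, minKer, mul_assoc]
    linarith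

lemma continuous_slabNorm : Continuous fun p : ℝ × (Fin 2 → ℝ) => slabNorm p.1 p.2 := by
  unfold slabNorm; fun_prop

lemma enorm_integral_slice_rieszKer_le' (f : Fin 3 → 𝓢(E3, ℝ))
    (hdiv : ∀ x, ∑ k, coordDeriv k (f k) x = 0) (i j : Fin 3) {δ ε s t : ℝ} (hδ : 0 < δ)
    (hε : 0 < ε) (hst : s - t ≠ 0) (hfi : Integrable fun z => f j (insCoord j (t, z)))
    (w : Fin 2 → ℝ) :
    ‖∫ z, f j (insCoord j (t, z)) * rieszKer δ i (insCoord j (s - t, w - z))‖ₑ ≤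
      3 * (∫⁻ z, ‖f j (insCoord j (t, z))‖ₑ * ENNReal.ofReal (minKer ε (s - t) (w - z))) +
      ENNReal.ofReal (4 * ε⁻¹) * ∫⁻ s', ∫⁻ z,
        (∑ k : Fin 2, ‖f (j.succAbove k) (insCoord j (s', z))‖ₑ) *
          ENNReal.ofReal (minKer ε (s - t) (w - z)) := by
  rcases le_total ε δ with h | h
  · exact (enorm_integral_slice_rieszKer_le f hdiv i j hε h hst w).trans le_add_self
  have hcont : Continuous fun z : Fin 2 → ℝ => insCoord j (s - t, w - z) :=
    (continuous_insCoord j).comp (by fun_prop)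
  have hi : ∀ {η : ℝ}, 0 < η → Integrable fun z =>
      f j (insCoord j (t, z)) * rieszKer η i (insCoord j (s - t, w - z)) := fun hη =>
    hfi.mul_bdd ((continuous_rieszKer hη i).comp hcont).aestronglyMeasurable
      (ae_of_all _ fun z => abs_rieszKer_le hη i _)
  have e : ∫ z, f j (insCoord j (t, z)) * rieszKer δ i (insCoord j (s - t, w - z)) =
      (∫ z, f j (insCoord j (t, z)) * (rieszKer δ i (insCoord j (s - t, w - z)) -
        rieszKer ε i (insCoord j (s - t, w - z)))) +
      ∫ z, f j (insCoord j (t, z)) * rieszKer ε i (insCoord j (s - t, w - z)) := by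
    simp_rw [mul_sub]
    rw [integral_sub (hi hδ) (hi hε)]; ring
  rw [e]
  refine (enorm_add_le _ _).trans (add_le_add ?_
    (enorm_integral_slice_rieszKer_le f hdiv i j hε le_rfl hst w))
  refine (enorm_integral_le_lintegral_enorm _).trans ?_
  rw [← lintegral_const_mul' _ _ (by norm_num)]
  refine lintegral_mono fun z => ?_
  rw [enorm_mul, mul_left_comm]
  gcongr
  have := abs_rieszKer_sub_le hδ h i (insCoord_ne_zero j hst (w - z))
  rw [norm_insCoord] at this
  rw [Real.enorm_eq_ofReal_abs, show (3 : ℝ≥0∞) = ENNReal.ofReal 3 by norm_num,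
    ← ENNReal.ofReal_mul (by norm_num)]
  exact ENNReal.ofReal_le_ofReal this

lemma continuous_slabNorm_right (τ : ℝ) : Continuous (slabNorm τ) :=
  continuous_slabNorm.comp (by fun_prop : Continuous fun z : Fin 2 → ℝ => (τ, z))

lemma abs_le_slabNorm (τ : ℝ) (z : Fin 2 → ℝ) : |τ| ≤ slabNorm τ z := by
  rw [slabNorm, ← Real.sqrt_sq_eq_abs]
  exact Real.sqrt_le_sqrt (le_add_of_nonneg_right (Finset.sum_nonneg fun k _ => sq_nonneg _))

lemma slabNorm_pos {τ : ℝ} (hτ : τ ≠ 0) (z : Fin 2 → ℝ) : 0 < slabNorm τ z :=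
  (abs_pos.2 hτ).trans_le (abs_le_slabNorm τ z)

lemma slabNorm_eq_abs_mul {τ : ℝ} (hτ : τ ≠ 0) (z : Fin 2 → ℝ) :
    slabNorm τ z = |τ| * slabNorm 1 (τ⁻¹ • z) := by
  rw [slabNorm, slabNorm, ← Real.sqrt_sq_eq_abs, ← Real.sqrt_mul (sq_nonneg τ), mul_add,
    Finset.mul_sum]
  congr 2
  · ring
  · refine Finset.sum_congr rfl fun k _ => ?_
    simp only [Pi.smul_apply, smul_eq_mul]
    field_simp

lemma one_add_norm_sq_le_slabNorm_sq (z : Fin 2 → ℝ) : 1 + ‖z‖ ^ 2 ≤ slabNorm 1 z ^ 2 := by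
  have h0 : 0 ≤ ∑ k, z k ^ 2 := Finset.sum_nonneg fun k _ => sq_nonneg _
  rw [slabNorm, Real.sq_sqrt (by positivity), one_pow]
  gcongr
  have : ‖z‖ ≤ √(∑ k, z k ^ 2) := by
    refine (pi_norm_le_iff_of_nonneg (Real.sqrt_nonneg _)).2 fun k => ?_
    rw [Real.norm_eq_abs]
    exact Real.abs_le_sqrt
      (Finset.single_le_sum (f := fun k => z k ^ 2) (fun k _ => sq_nonneg _) (Finset.mem_univ k))
  calc ‖z‖ ^ 2 ≤ √(∑ k, z k ^ 2) ^ 2 := by gcongr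
    _ = _ := Real.sq_sqrt h0

lemma integrable_slabNorm_one_rpow {q : ℝ} (hq : 2 < q) :
    Integrable (fun z => slabNorm 1 z ^ (-q)) := by
  have h : Integrable (fun z : Fin 2 → ℝ => ((1 : ℝ) + ‖z‖ ^ 2) ^ (-q / 2)) :=
    integrable_rpow_neg_one_add_norm_sq (by simpa using hq)
  refine h.mono' ?_ (ae_of_all _ fun z => ?_)
  · exact ((continuous_slabNorm_right 1).rpow_const
      fun z => Or.inl (slabNorm_pos one_ne_zero z).ne').aestronglyMeasurable
  · have hp := slabNorm_pos one_ne_zero z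
    rw [Real.norm_of_nonneg (by positivity)]
    calc slabNorm 1 z ^ (-q) = (slabNorm 1 z ^ 2) ^ (-q / 2) := by
          rw [← Real.rpow_natCast, ← Real.rpow_mul hp.le]; congr 1; push_cast; ring
      _ ≤ _ := Real.rpow_le_rpow_of_nonpos (by positivity) (one_add_norm_sq_le_slabNorm_sq z)
          (by linarith)

lemma lintegral_slabNorm_rpow {q τ : ℝ} (hq : 2 < q) (hτ : τ ≠ 0) (w₀ : Fin 2 → ℝ) :
    ∫⁻ w, ENNReal.ofReal (slabNorm τ (w - w₀) ^ (-q)) =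
      ENNReal.ofReal (|τ| ^ (2 - q) * ∫ z, slabNorm 1 z ^ (-q)) := by
  rw [lintegral_sub_right_eq_self (fun w => ENNReal.ofReal (slabNorm τ w ^ (-q)))]
  have hτ' := abs_pos.2 hτ
  have e : ∀ w, slabNorm τ w ^ (-q) = |τ| ^ (-q) * slabNorm 1 (τ⁻¹ • w) ^ (-q) := fun w => by
    rw [slabNorm_eq_abs_mul hτ, Real.mul_rpow hτ'.le (slabNorm_pos one_ne_zero _).le]
  simp_rw [e]
  rw [← ofReal_integral_eq_lintegral_ofReal
    (((integrable_slabNorm_one_rpow hq).comp_smul (inv_ne_zero hτ)).const_mul _)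
    (ae_of_all _ fun w => by have := slabNorm_pos one_ne_zero (τ⁻¹ • w); positivity),
    integral_const_mul,
    Measure.integral_comp_inv_smul volume (fun z => slabNorm 1 z ^ (-q)) τ]
  congr 1
  rw [smul_eq_mul, ← mul_assoc]
  congr 1
  rw [sub_eq_neg_add, Real.rpow_add hτ']
  simp

lemma lintegral_mul_slabNorm_rpow_le {a : (Fin 2 → ℝ) → ℝ≥0∞} (ha : AEMeasurable a)
    {p τ : ℝ} (hp : 4 / 3 < p) (hτ : τ ≠ 0) (z : Fin 2 → ℝ) :
    ∫⁻ w, a w * ENNReal.ofReal (slabNorm τ (w - z) ^ (-p)) ≤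
      (∫⁻ w, a w ^ (3 : ℝ)) ^ (1 / 3 : ℝ) *
        ENNReal.ofReal ((∫ z, slabNorm 1 z ^ (-(3 / 2 * p))) ^ (2 / 3 : ℝ) *
          |τ| ^ (4 / 3 - p)) := by
  have hτ' := abs_pos.2 hτ
  have hm : Measurable fun w => ENNReal.ofReal (slabNorm τ (w - z) ^ (-p)) :=
    ENNReal.measurable_ofReal.comp (((continuous_slabNorm_right τ).measurable.comp
      (measurable_id.sub_const z)).pow_const _)
  refine (ENNReal.lintegral_mul_le_Lp_mul_Lq volume (p := 3) (q := 3 / 2)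
    (by rw [Real.holderConjugate_iff]; norm_num) ha hm.aemeasurable).trans_eq ?_
  congr 1
  have e : ∀ w, ENNReal.ofReal (slabNorm τ (w - z) ^ (-p)) ^ (3 / 2 : ℝ) =
      ENNReal.ofReal (slabNorm τ (w - z) ^ (-(3 / 2 * p))) := fun w => by
    have h := slabNorm_pos hτ (w - z)
    rw [ENNReal.ofReal_rpow_of_nonneg (by positivity) (by norm_num), ← Real.rpow_mul h.le]
    congr 2; ring
  simp_rw [e]
  have hI : 0 ≤ ∫ z, slabNorm 1 z ^ (-(3 / 2 * p)) :=
    integral_nonneg fun z => Real.rpow_nonneg (slabNorm_pos one_ne_zero z).le _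
  rw [lintegral_slabNorm_rpow (by linarith) hτ, ENNReal.ofReal_rpow_of_nonneg (by positivity)
    (by norm_num), Real.mul_rpow (by positivity) hI, ← Real.rpow_mul hτ'.le, mul_comm]
  congr 3
  · norm_num
  · ring

lemma exists_lintegral_mul_minKer_le : ∃ C : ℝ, 0 < C ∧ ∀ {a : (Fin 2 → ℝ) → ℝ≥0∞},
    AEMeasurable a → ∀ {ε τ : ℝ}, 0 < ε → τ ≠ 0 → ∀ z : Fin 2 → ℝ,
      ∫⁻ w, a w * ENNReal.ofReal (minKer ε τ (w - z)) ≤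
        ENNReal.ofReal C * ((∫⁻ w, a w ^ (3 : ℝ)) ^ (1 / 3 : ℝ) *
          ENNReal.ofReal (min (|τ| ^ (-(2 / 3) : ℝ)) (ε * |τ| ^ (-(5 / 3) : ℝ)))) := by
  have hI : ∀ q : ℝ, 0 ≤ ∫ z, slabNorm 1 z ^ (-q) := fun q =>
    integral_nonneg fun z => Real.rpow_nonneg (slabNorm_pos one_ne_zero z).le _
  set A : ℝ := (∫ z, slabNorm 1 z ^ (-(3 / 2 * 2) : ℝ)) ^ (2 / 3 : ℝ)
  set B : ℝ := (∫ z, slabNorm 1 z ^ (-(3 / 2 * 3) : ℝ)) ^ (2 / 3 : ℝ)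
  have hA : 0 ≤ A := Real.rpow_nonneg (hI _) _
  have hB : 0 ≤ B := Real.rpow_nonneg (hI _) _
  have hA' : A ≤ A + B + 1 := by linarith
  have hB' : B ≤ A + B + 1 := by linarith
  refine ⟨A + B + 1, by positivity, fun {a} ha {ε τ} hε hτ z => ?_⟩
  have hτ' := abs_pos.2 hτ
  rw [mul_left_comm, ← ENNReal.ofReal_mul (by positivity), mul_min_of_nonneg _ _ (by positivity),
    ENNReal.ofReal_min, mul_min]
  refine le_min ?_ ?_
  · calc _ ≤ ∫⁻ w, a w * ENNReal.ofReal (slabNorm τ (w - z) ^ (-2 : ℝ)) := by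
          refine lintegral_mono fun w => ?_
          gcongr
          refine (min_le_left _ _).trans_eq ?_
          rw [Real.rpow_neg (slabNorm_pos hτ _).le]; norm_cast
      _ ≤ _ := lintegral_mul_slabNorm_rpow_le ha (by norm_num) hτ z
      _ ≤ _ := by
          rw [show (4 / 3 - 2 : ℝ) = -(2 / 3) by norm_num]
          gcongr _ * ENNReal.ofReal (?_ * _)
  · calc _ ≤ ∫⁻ w, ENNReal.ofReal ε * (a w * ENNReal.ofReal (slabNorm τ (w - z) ^ (-3 : ℝ))) := by
          refine lintegral_mono fun w => ?_
          rw [mul_left_comm, ← ENNReal.ofReal_mul hε.le]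
          gcongr
          refine (min_le_right _ _).trans_eq ?_
          rw [Real.rpow_neg (slabNorm_pos hτ _).le]; norm_cast
      _ = _ := lintegral_const_mul' _ _ ENNReal.ofReal_ne_top
      _ ≤ ENNReal.ofReal ε * _ :=
          mul_le_mul_right (lintegral_mul_slabNorm_rpow_le ha (by norm_num) hτ z) _
      _ ≤ _ := by
          rw [mul_left_comm, ← ENNReal.ofReal_mul hε.le, mul_left_comm _ ε,
            show (4 / 3 - 3 : ℝ) = -(5 / 3) by norm_num]
          gcongr _ * ENNReal.ofReal (ε * (?_ * _))

/-- The kernel `min (|r|^{-2/3}, |r|^{-5/3})` on the line. -/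
def lineKer (r : ℝ) : ℝ := min (|r| ^ (-(2 / 3) : ℝ)) (|r| ^ (-(5 / 3) : ℝ))

lemma lineKer_nonneg (r : ℝ) : 0 ≤ lineKer r :=
  le_min (Real.rpow_nonneg (abs_nonneg r) _) (Real.rpow_nonneg (abs_nonneg r) _)

lemma measurable_lineKer : Measurable lineKer := by
  unfold lineKer; fun_prop

lemma integrable_lineKer : Integrable lineKer := by
  have hIoc : IntegrableOn lineKer (Set.Ioc 0 1) := by
    have h : IntegrableOn (fun r : ℝ => r ^ (-(2 / 3) : ℝ)) (Set.Ioc 0 1) :=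
      (intervalIntegrable_iff_integrableOn_Ioc_of_le zero_le_one).1
        (intervalIntegral.intervalIntegrable_rpow' (by norm_num))
    refine h.mono' measurable_lineKer.aestronglyMeasurable ?_
    filter_upwards [ae_restrict_mem measurableSet_Ioc] with r hr
    rw [Real.norm_of_nonneg (lineKer_nonneg r), lineKer, abs_of_pos hr.1]
    exact min_le_left _ _
  have hIoi : IntegrableOn lineKer (Set.Ioi 1) := by
    have h : IntegrableOn (fun r : ℝ => r ^ (-(5 / 3) : ℝ)) (Set.Ioi 1) :=
      integrableOn_Ioi_rpow_of_lt (by norm_num) one_pos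
    refine h.mono' measurable_lineKer.aestronglyMeasurable ?_
    filter_upwards [ae_restrict_mem measurableSet_Ioi] with r hr
    rw [Real.norm_of_nonneg (lineKer_nonneg r), lineKer,
      abs_of_pos (zero_lt_one.trans (Set.mem_Ioi.1 hr))]
    exact min_le_right _ _
  have hpos : IntegrableOn lineKer (Set.Ioi 0) := by
    rw [← Set.Ioc_union_Ioi_eq_Ioi (zero_le_one' ℝ)]
    exact hIoc.union hIoi
  have hneg : IntegrableOn lineKer (Set.Iic 0) := by
    rw [← Measure.map_neg_eq_self (volume : Measure ℝ)]
    have m : MeasurableEmbedding fun x : ℝ => -x := (Homeomorph.neg ℝ).measurableEmbedding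
    have e : lineKer ∘ (fun x : ℝ => -x) = lineKer := by
      ext x; simp [lineKer]
    rw [m.integrableOn_map_iff, e]
    simp only [Set.neg_preimage, Set.neg_Iic, neg_zero]
    rwa [integrableOn_Ici_iff_integrableOn_Ioi]
  rw [← integrableOn_univ, ← Set.Iic_union_Ioi (a := (0 : ℝ))]
  exact hneg.union hpos

lemma lintegral_sq_mul_lineKer {y : ℝ} (hy : 0 ≤ y) :
    ∫⁻ t, ENNReal.ofReal (y ^ 2 * lineKer (y * t)) = ENNReal.ofReal (y * ∫ r, lineKer r) := by
  rcases hy.eq_or_lt with rfl | hy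
  · simp
  rw [← ofReal_integral_eq_lintegral_ofReal ((integrable_lineKer.comp_mul_left' hy.ne').const_mul _)
    (ae_of_all _ fun t => mul_nonneg (sq_nonneg _) (lineKer_nonneg _)), integral_const_mul,
    Measure.integral_comp_mul_left, smul_eq_mul, abs_of_pos (inv_pos.2 hy)]
  congr 1
  field_simp

lemma mul_min_pow_le {a c : ℝ} (ha : 0 ≤ a) (hc : 0 ≤ c) :
    a * min (c ^ 3) 1 ≤ min (a ^ 4) a + min (c ^ 4) c := by
  have h1 : 0 ≤ min (a ^ 4) a := by positivity
  have h2 : 0 ≤ min (c ^ 4) c := by positivity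
  rcases le_total 1 a with h | h
  · have : a ≤ a ^ 4 := le_self_pow₀ h (by norm_num)
    rw [min_eq_right this]
    have : a * min (c ^ 3) 1 ≤ a * 1 := by gcongr; exact min_le_right _ _
    linarith
  rcases le_total 1 c with h' | h'
  · have : c ≤ c ^ 4 := le_self_pow₀ h' (by norm_num)
    rw [min_eq_right this]
    have : a * min (c ^ 3) 1 ≤ a * 1 := by gcongr; exact min_le_right _ _
    linarith
  have ha' : a ^ 4 ≤ a := pow_le_of_le_one ha h (by norm_num)
  have hc' : c ^ 4 ≤ c := pow_le_of_le_one hc h' (by norm_num)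
  rw [min_eq_left ha', min_eq_left hc']
  have : a * min (c ^ 3) 1 ≤ a * c ^ 3 := by gcongr; exact min_le_left _ _
  rcases le_total a c with h | h
  · have : a * c ^ 3 ≤ c * c ^ 3 := by gcongr
    nlinarith [pow_nonneg ha 4]
  · have : a * c ^ 3 ≤ a * a ^ 3 := by gcongr
    nlinarith [pow_nonneg hc 4]

lemma rpow_neg_div_three {q : ℝ} (hq : 0 < q) (n : ℕ) :
    |q ^ 3| ^ (-(n / 3) : ℝ) = (q ^ n)⁻¹ := by
  rw [abs_of_pos (by positivity), ← Real.rpow_natCast, ← Real.rpow_mul hq.le,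
    ← Real.rpow_natCast, ← Real.rpow_neg hq.le]
  congr 1; push_cast; ring

lemma lineKer_pow_three {q : ℝ} (hq : 0 < q) :
    lineKer (q ^ 3) = min (q ^ 2)⁻¹ (q ^ 5)⁻¹ := by
  have h2 := rpow_neg_div_three hq 2
  have h5 := rpow_neg_div_three hq 5
  push_cast at h2 h5
  rw [lineKer, h2, h5]

lemma sq_mul_lineKer_pow_three {x q : ℝ} (hx : 0 ≤ x) (hq : 0 < q) :
    (x ^ 3) ^ 2 * lineKer (x ^ 3 * q ^ 3) = (q ^ 6)⁻¹ * min ((x * q) ^ 4) (x * q) := by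
  rcases hx.eq_or_lt with rfl | hx
  · simp
  rw [← mul_pow, lineKer_pow_three (by positivity), mul_min_of_nonneg _ _ (by positivity),
    mul_min_of_nonneg _ _ (by positivity)]
  congr 1 <;> field_simp

lemma mul_min_rpow_le {g μ r : ℝ} (hg : 0 ≤ g) (hμ : 0 ≤ μ) (hr : r ≠ 0) :
    g * min (μ * |r| ^ (-(2 / 3) : ℝ)) (|r| ^ (-(5 / 3) : ℝ)) ≤
      (g ^ 3) ^ 2 * lineKer (g ^ 3 * r) + μ ^ 2 * lineKer (μ * r) := by
  have key : ∀ {n q : ℝ}, 0 ≤ n → 0 < q →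
      g * min (n ^ 3 * |q ^ 3| ^ (-(2 / 3) : ℝ)) (|q ^ 3| ^ (-(5 / 3) : ℝ)) ≤
      (g ^ 3) ^ 2 * lineKer (g ^ 3 * q ^ 3) + (n ^ 3) ^ 2 * lineKer (n ^ 3 * q ^ 3) := by
    intro n q hn hq
    have h2 := rpow_neg_div_three hq 2
    have h5 := rpow_neg_div_three hq 5
    push_cast at h2 h5
    rw [h2, h5, sq_mul_lineKer_pow_three hg hq, sq_mul_lineKer_pow_three hn hq, ← mul_add]
    have e : g * min (n ^ 3 * (q ^ 2)⁻¹) (q ^ 5)⁻¹ =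
        (q ^ 6)⁻¹ * ((g * q) * min ((n * q) ^ 3) 1) := by
      rw [mul_min_of_nonneg _ _ hg, mul_min_of_nonneg _ _ (by positivity),
        mul_min_of_nonneg _ _ (by positivity)]
      congr 1 <;> field_simp
    rw [e]
    exact mul_le_mul_of_nonneg_left (mul_min_pow_le (by positivity) (by positivity))
      (by positivity)
  have hcube : ∀ {x : ℝ}, 0 ≤ x → (x ^ (1 / 3 : ℝ)) ^ 3 = x := fun hx => by
    rw [← Real.rpow_natCast, ← Real.rpow_mul hx]; norm_num
  have hr' := abs_pos.2 hr
  have habs : ∀ x : ℝ, 0 ≤ x → lineKer (x * |r|) = lineKer (x * r) := fun x _ => by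
    simp [lineKer, abs_mul]
  have := key (n := μ ^ (1 / 3 : ℝ)) (q := |r| ^ (1 / 3 : ℝ)) (by positivity) (by positivity)
  rwa [hcube hμ, hcube hr'.le, abs_abs, habs _ (by positivity), habs _ hμ] at this

lemma measurable_minKer (ε τ : ℝ) : Measurable (minKer ε τ) := by
  unfold minKer slabNorm; fun_prop

lemma measurable_ofReal_minKer_sub {α : Type*} [MeasurableSpace α] (ε τ : ℝ)
    {ζ : α → (Fin 2 → ℝ)} (hζ : Measurable ζ) :
    Measurable fun p : (Fin 2 → ℝ) × α => ENNReal.ofReal (minKer ε τ (p.1 - ζ p.2)) := by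
  have h := measurable_minKer ε τ
  fun_prop

lemma lintegral_mul_lintegral_mul_minKer_le {α : Type*} [MeasureSpace α]
    [SFinite (volume : Measure α)] {a : (Fin 2 → ℝ) → ℝ≥0∞} (ha : Measurable a) {ε τ : ℝ}
    {A : ℝ≥0∞} (hA : ∀ z, ∫⁻ w, a w * ENNReal.ofReal (minKer ε τ (w - z)) ≤ A)
    {F : α → ℝ≥0∞} (hF : Measurable F) {ζ : α → (Fin 2 → ℝ)} (hζ : Measurable ζ) :
    ∫⁻ w, a w * ∫⁻ y, F y * ENNReal.ofReal (minKer ε τ (w - ζ y)) ≤ (∫⁻ y, F y) * A := by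
  have hK := measurable_minKer ε τ
  have e : ∀ w, a w * ∫⁻ y, F y * ENNReal.ofReal (minKer ε τ (w - ζ y)) =
      ∫⁻ y, F y * (a w * ENNReal.ofReal (minKer ε τ (w - ζ y))) := fun w => by
    rw [← lintegral_const_mul _ (by fun_prop)]
    simp_rw [mul_left_comm]
  simp_rw [e]
  have hm : Measurable fun p : (Fin 2 → ℝ) × α =>
      F p.2 * (a p.1 * ENNReal.ofReal (minKer ε τ (p.1 - ζ p.2))) := by fun_prop
  rw [lintegral_lintegral_swap hm.aemeasurable, ← lintegral_mul_const _ hF]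
  refine lintegral_mono fun y => ?_
  rw [lintegral_const_mul _ (by fun_prop)]
  gcongr
  exact hA _

lemma measurable_enorm_comp_insCoord (u : 𝓢(E3, ℝ)) (j : Fin 3) :
    Measurable fun p : ℝ × (Fin 2 → ℝ) => ‖u (insCoord j p)‖ₑ :=
  (u.continuous.comp (continuous_insCoord j)).measurable.enorm

lemma lintegral_comp_insCoord (j : Fin 3) {F : E3 → ℝ≥0∞} (hF : Measurable F) :
    ∫⁻ s, ∫⁻ z, F (insCoord j (s, z)) = ∫⁻ x, F x := by
  rw [← (measurePreserving_insCoord j).lintegral_comp hF, Measure.volume_eq_prod,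
    lintegral_prod (fun p => F (insCoord j p)) (hF.comp (insCoord j).measurable).aemeasurable]

lemma exists_lintegral_mul_slice_le : ∃ C : ℝ, 0 < C ∧
    ∀ (f : Fin 3 → 𝓢(E3, ℝ)), (∀ x, ∑ k, coordDeriv k (f k) x = 0) → ∀ (i j : Fin 3)
      {δ M s t : ℝ}, 0 < δ → 0 < M → ∑ k, ∫⁻ x, ‖f k x‖ₑ ≤ ENNReal.ofReal M → s - t ≠ 0 →
      (Integrable fun z => f j (insCoord j (t, z))) →
      ∀ {a : (Fin 2 → ℝ) → ℝ≥0∞}, Measurable a →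
      ∫⁻ w, a w * ‖∫ z, f j (insCoord j (t, z)) * rieszKer δ i (insCoord j (s - t, w - z))‖ₑ ≤
        ENNReal.ofReal C * ((∫⁻ w, a w ^ (3 : ℝ)) ^ (1 / 3 : ℝ) *
          ENNReal.ofReal (min ((∫ z, ‖f j (insCoord j (t, z))‖) * |s - t| ^ (-(2 / 3) : ℝ))
            (M * |s - t| ^ (-(5 / 3) : ℝ)))) := by
  obtain ⟨C, hC, h⟩ := exists_lintegral_mul_minKer_le
  refine ⟨7 * C, by positivity, ?_⟩
  intro f hdiv i j δ M s t hδ hM hfM hst hfi a ha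
  set m : ℝ := ∫ z, ‖f j (insCoord j (t, z))‖ with hm
  have hm0 : 0 ≤ m := integral_nonneg fun z => norm_nonneg _
  rcases hm0.eq_or_lt with hm0 | hm0
  · have hz : (fun z => ‖f j (insCoord j (t, z))‖) =ᵐ[volume] 0 :=
      (integral_eq_zero_iff_of_nonneg (fun z => norm_nonneg _) hfi.norm).1 hm0.symm
    have hB : ∀ w, ∫ z, f j (insCoord j (t, z)) * rieszKer δ i (insCoord j (s - t, w - z)) = 0 := by
      intro w
      refine integral_eq_zero_of_ae ?_
      filter_upwards [hz] with z hz
      rw [norm_eq_zero.1 hz]; simp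
    simp [hB]
  set ε : ℝ := M / m
  have hε : 0 < ε := by positivity
  have hm' : ∫⁻ z, ‖f j (insCoord j (t, z))‖ₑ = ENNReal.ofReal m :=
    (ofReal_integral_norm_eq_lintegral_enorm hfi).symm
  set G : ℝ≥0∞ := (∫⁻ w, a w ^ (3 : ℝ)) ^ (1 / 3 : ℝ)
  set κ : ℝ := min (|s - t| ^ (-(2 / 3) : ℝ)) (ε * |s - t| ^ (-(5 / 3) : ℝ))
  have hmu : ∀ t, Measurable fun z : Fin 2 → ℝ => ‖f j (insCoord j (t, z))‖ₑ :=
    fun t => (measurable_enorm_comp_insCoord (f j) j).comp measurable_prodMk_left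
  have hS : Measurable fun p : ℝ × (Fin 2 → ℝ) =>
      ∑ k : Fin 2, ‖f (j.succAbove k) (insCoord j p)‖ₑ :=
    Finset.measurable_sum _ fun k _ => measurable_enorm_comp_insCoord _ j
  have hSM : ∫⁻ p : ℝ × (Fin 2 → ℝ), ∑ k : Fin 2, ‖f (j.succAbove k) (insCoord j p)‖ₑ ≤
      ENNReal.ofReal M := by
    refine le_trans ?_ hfM
    rw [lintegral_finsetSum _ fun k _ => measurable_enorm_comp_insCoord _ j,
      Fin.sum_univ_succAbove _ j]
    refine le_trans (le_of_eq (Finset.sum_congr rfl fun k _ => ?_)) le_add_self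
    exact (measurePreserving_insCoord j).lintegral_comp
      (f (j.succAbove k)).continuous.measurable.enorm
  have hK0 := measurable_minKer ε (s - t)
  have hK := measurable_ofReal_minKer_sub ε (s - t) (measurable_snd (α := ℝ) (β := Fin 2 → ℝ))
  have hconv : ∀ w, ∫⁻ s', ∫⁻ z, (∑ k : Fin 2, ‖f (j.succAbove k) (insCoord j (s', z))‖ₑ) *
      ENNReal.ofReal (minKer ε (s - t) (w - z)) =
      ∫⁻ p : ℝ × (Fin 2 → ℝ), (∑ k : Fin 2, ‖f (j.succAbove k) (insCoord j p)‖ₑ) *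
        ENNReal.ofReal (minKer ε (s - t) (w - p.2)) := fun w => by
    have hKw : Measurable fun p : ℝ × (Fin 2 → ℝ) => ENNReal.ofReal (minKer ε (s - t) (w - p.2)) :=
      by fun_prop
    rw [Measure.volume_eq_prod, lintegral_prod (fun p : ℝ × (Fin 2 → ℝ) =>
      (∑ k : Fin 2, ‖f (j.succAbove k) (insCoord j p)‖ₑ) *
        ENNReal.ofReal (minKer ε (s - t) (w - p.2))) (hS.mul hKw).aemeasurable]
  calc _ ≤ ∫⁻ w, (3 * (a w * ∫⁻ z, ‖f j (insCoord j (t, z))‖ₑ *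
          ENNReal.ofReal (minKer ε (s - t) (w - z))) +
        ENNReal.ofReal (4 * ε⁻¹) * (a w * ∫⁻ p : ℝ × (Fin 2 → ℝ),
          (∑ k : Fin 2, ‖f (j.succAbove k) (insCoord j p)‖ₑ) *
            ENNReal.ofReal (minKer ε (s - t) (w - p.2)))) := by
        refine lintegral_mono fun w => ?_
        refine (mul_le_mul_right
          (enorm_integral_slice_rieszKer_le' f hdiv i j hδ hε hst hfi w) (a w)).trans_eq ?_
        rw [hconv]
        ring
    _ = 3 * (∫⁻ w, a w * ∫⁻ z, ‖f j (insCoord j (t, z))‖ₑ *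
          ENNReal.ofReal (minKer ε (s - t) (w - z))) +
        ENNReal.ofReal (4 * ε⁻¹) * ∫⁻ w, a w * ∫⁻ p : ℝ × (Fin 2 → ℝ),
          (∑ k : Fin 2, ‖f (j.succAbove k) (insCoord j p)‖ₑ) *
            ENNReal.ofReal (minKer ε (s - t) (w - p.2)) := by
        have hm1 : Measurable fun w => a w * ∫⁻ z, ‖f j (insCoord j (t, z))‖ₑ *
            ENNReal.ofReal (minKer ε (s - t) (w - z)) :=
          ha.mul (Measurable.lintegral_prod_right' (((hmu t).comp measurable_snd).mul
            (measurable_ofReal_minKer_sub ε (s - t) measurable_id)))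
        have hm2 : Measurable fun w => a w * ∫⁻ p : ℝ × (Fin 2 → ℝ),
            (∑ k : Fin 2, ‖f (j.succAbove k) (insCoord j p)‖ₑ) *
              ENNReal.ofReal (minKer ε (s - t) (w - p.2)) :=
          ha.mul (Measurable.lintegral_prod_right' ((hS.comp measurable_snd).mul hK))
        rw [lintegral_add_left (hm1.const_mul _), lintegral_const_mul _ hm1,
          lintegral_const_mul _ hm2]
    _ ≤ 3 * (ENNReal.ofReal m * (ENNReal.ofReal C * (G * ENNReal.ofReal κ))) +
        ENNReal.ofReal (4 * ε⁻¹) *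
          (ENNReal.ofReal M * (ENNReal.ofReal C * (G * ENNReal.ofReal κ))) := by
        gcongr 3 * ?_ + _ * ?_
        · rw [← hm']
          exact lintegral_mul_lintegral_mul_minKer_le ha (h ha.aemeasurable hε hst)
            (hmu t) measurable_id
        · exact (lintegral_mul_lintegral_mul_minKer_le ha (h ha.aemeasurable hε hst)
            hS measurable_snd).trans (mul_le_mul_left hSM _)
    _ = ENNReal.ofReal (3 * m * C * κ + 4 * ε⁻¹ * M * C * κ) * G := by
        have hκ : 0 ≤ κ := by positivity
        rw [ENNReal.ofReal_add (by positivity) (by positivity),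
          ENNReal.ofReal_mul (p := 3 * m * C) (by positivity),
          ENNReal.ofReal_mul (p := 3 * m) (by positivity),
          ENNReal.ofReal_mul (p := 3) (by norm_num),
          ENNReal.ofReal_mul (p := 4 * ε⁻¹ * M * C) (by positivity),
          ENNReal.ofReal_mul (p := 4 * ε⁻¹ * M) (by positivity),
          ENNReal.ofReal_mul (p := 4 * ε⁻¹) (by positivity), ENNReal.ofReal_ofNat]
        ring
    _ = _ := by
        rw [mul_left_comm, ← ENNReal.ofReal_mul (by positivity), mul_comm]
        congr 2
        have e1 : min (m * |s - t| ^ (-(2 / 3) : ℝ)) (M * |s - t| ^ (-(5 / 3) : ℝ)) = m * κ := by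
          rw [mul_min_of_nonneg _ _ hm0.le]
          congr 1
          simp only [ε]; field_simp
        rw [e1]
        simp only [ε]; field_simp; ring

lemma ofReal_rpow_mul_min_le {G : ℝ≥0∞} (hG : G ≠ ∞) {m M l r : ℝ} (hm : 0 ≤ m) (hM : 0 < M)
    (hl : 0 < l) (hr : r ≠ 0) :
    G ^ (1 / 3 : ℝ) *
        ENNReal.ofReal (min (m * |r| ^ (-(2 / 3) : ℝ)) (M * |r| ^ (-(5 / 3) : ℝ))) ≤
      ENNReal.ofReal (M * l⁻¹) *
        (ENNReal.ofReal ((l ^ 3 * G.toReal) ^ 2 * lineKer (l ^ 3 * G.toReal * r)) +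
          ENNReal.ofReal ((m / M) ^ 2 * lineKer (m / M * r))) := by
  obtain ⟨y, hy, rfl⟩ : ∃ y : ℝ, 0 ≤ y ∧ G = ENNReal.ofReal y :=
    ⟨G.toReal, ENNReal.toReal_nonneg, (ENNReal.ofReal_toReal hG).symm⟩
  have hk := lineKer_nonneg
  rw [ENNReal.toReal_ofReal hy, ENNReal.ofReal_rpow_of_nonneg hy (by norm_num),
    ← ENNReal.ofReal_mul (by positivity),
    ← ENNReal.ofReal_add (mul_nonneg (sq_nonneg _) (hk _)) (mul_nonneg (sq_nonneg _) (hk _)),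
    ← ENNReal.ofReal_mul (by positivity)]
  refine ENNReal.ofReal_le_ofReal ?_
  have hcube : (y ^ (1 / 3 : ℝ)) ^ 3 = y := by
    rw [← Real.rpow_natCast, ← Real.rpow_mul hy]; norm_num
  have h := mul_min_rpow_le (g := l * y ^ (1 / 3 : ℝ)) (μ := m / M) (r := r) (by positivity)
    (by positivity) hr
  rw [mul_pow l, hcube] at h
  have e : y ^ (1 / 3 : ℝ) * min (m * |r| ^ (-(2 / 3) : ℝ)) (M * |r| ^ (-(5 / 3) : ℝ)) =
      M * l⁻¹ * (l * y ^ (1 / 3 : ℝ) *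
        min (m / M * |r| ^ (-(2 / 3) : ℝ)) (|r| ^ (-(5 / 3) : ℝ))) := by
    have : min (m * |r| ^ (-(2 / 3) : ℝ)) (M * |r| ^ (-(5 / 3) : ℝ)) =
        M * min (m / M * |r| ^ (-(2 / 3) : ℝ)) (|r| ^ (-(5 / 3) : ℝ)) := by
      rw [mul_min_of_nonneg _ _ hM.le]
      congr 1; field_simp
    rw [this]; field_simp
  rw [e]
  exact mul_le_mul_of_nonneg_left h (by positivity)

lemma exists_lintegral_slices_le : ∃ C : ℝ, 0 < C ∧
    ∀ (f : Fin 3 → 𝓢(E3, ℝ)), (∀ x, ∑ k, coordDeriv k (f k) x = 0) → ∀ (i j : Fin 3)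
      {δ M l I : ℝ}, 0 < δ → 0 < M → 0 < l → 0 ≤ I →
      ∑ k, ∫⁻ x, ‖f k x‖ₑ ≤ ENNReal.ofReal M → ∀ {ψ : E3 → ℝ}, Continuous ψ →
      ∫⁻ x, ‖ψ x‖ₑ ^ (3 : ℝ) ≤ ENNReal.ofReal I →
      ∫⁻ s, ∫⁻ t, ∫⁻ w, ‖ψ (insCoord j (s, w))‖ₑ *
          ‖∫ z, f j (insCoord j (t, z)) * rieszKer δ i (insCoord j (s - t, w - z))‖ₑ ≤
        ENNReal.ofReal (C * M * l⁻¹ * (l ^ 3 * I + 1)) := by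
  obtain ⟨C, hC, h⟩ := exists_lintegral_mul_slice_le
  set K : ℝ := ∫ r, lineKer r
  have hK : 0 ≤ K := integral_nonneg lineKer_nonneg
  refine ⟨C * (K + 1), by positivity, ?_⟩
  intro f hdiv i j δ M l I hδ hM hl hI hfM ψ hψ hψI
  have hmeas : Measurable fun p : ℝ × (Fin 2 → ℝ) => ‖ψ (insCoord j p)‖ₑ :=
    (hψ.comp (continuous_insCoord j)).measurable.enorm
  set G : ℝ → ℝ≥0∞ := fun s => ∫⁻ w, ‖ψ (insCoord j (s, w))‖ₑ ^ (3 : ℝ) with hG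
  have hGm : Measurable G :=
    Measurable.lintegral_prod_right' (f := fun p : ℝ × (Fin 2 → ℝ) =>
      ‖ψ (insCoord j p)‖ₑ ^ (3 : ℝ)) (hmeas.pow_const _)
  have hGI : ∫⁻ s, G s ≤ ENNReal.ofReal I := by
    refine le_of_eq_of_le ?_ hψI
    exact lintegral_comp_insCoord j (F := fun x => ‖ψ x‖ₑ ^ (3 : ℝ))
      (hψ.measurable.enorm.pow_const _)
  have hGfin : ∀ᵐ s, G s < ∞ :=
    ae_lt_top hGm (hGI.trans_lt ENNReal.ofReal_lt_top).ne
  have hfi := integrable_comp_insCoord j (f j).integrable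
  set m : ℝ → ℝ := fun t => ∫ z, ‖f j (insCoord j (t, z))‖ with hm
  have hm0 : ∀ t, 0 ≤ m t := fun t => integral_nonneg fun z => norm_nonneg _
  have hfc : Continuous fun p : ℝ × (Fin 2 → ℝ) => ‖f j (insCoord j p)‖ :=
    ((f j).continuous.comp (continuous_insCoord j)).norm
  have hmm : Measurable m :=
    (StronglyMeasurable.integral_prod_right (f := fun t z => ‖f j (insCoord j (t, z))‖)
      hfc.stronglyMeasurable).measurable
  have hmM : ∫⁻ t, ENNReal.ofReal (m t) ≤ ENNReal.ofReal M := by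
    refine le_trans ?_ ((Finset.single_le_sum (f := fun k => ∫⁻ x, ‖f k x‖ₑ)
      (fun _ _ => zero_le) (Finset.mem_univ j)).trans hfM)
    rw [← lintegral_comp_insCoord j (f j).continuous.measurable.enorm]
    refine lintegral_mono_ae ?_
    filter_upwards [hfi.prod_right_ae] with t ht
    exact (ofReal_integral_norm_eq_lintegral_enorm ht).le
  have hker := measurable_lineKer
  set Q : ℝ → ℝ → ℝ≥0∞ := fun s t =>
    ENNReal.ofReal ((m t / M) ^ 2 * lineKer (m t / M * (s - t))) with hQ
  set P : ℝ → ℝ → ℝ≥0∞ := fun s t =>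
    ENNReal.ofReal ((l ^ 3 * (G s).toReal) ^ 2 * lineKer (l ^ 3 * (G s).toReal * (s - t))) with hP
  have hQm : Measurable (Function.uncurry Q) := by
    simp only [hQ, Function.uncurry_def]; fun_prop
  have hPm : ∀ s, Measurable (P s) := fun s => by simp only [hP]; fun_prop
  have hPint : ∀ s, ∫⁻ t, P s t = ENNReal.ofReal (l ^ 3 * (G s).toReal * K) := fun s => by
    have h0 : 0 ≤ l ^ 3 * (G s).toReal := by positivity
    rw [← lintegral_sq_mul_lineKer h0]
    exact lintegral_sub_left_eq_self (fun t => ENNReal.ofReal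
      ((l ^ 3 * (G s).toReal) ^ 2 * lineKer (l ^ 3 * (G s).toReal * t))) s
  have hQint : ∀ t, ∫⁻ s, Q s t = ENNReal.ofReal (m t / M * K) := fun t => by
    have h0 : 0 ≤ m t / M := div_nonneg (hm0 t) hM.le
    rw [← lintegral_sq_mul_lineKer h0]
    exact lintegral_sub_right_eq_self (fun s => ENNReal.ofReal
      ((m t / M) ^ 2 * lineKer (m t / M * s))) t
  have hle : ∀ᵐ s, ∫⁻ t, ∫⁻ w, ‖ψ (insCoord j (s, w))‖ₑ *
      ‖∫ z, f j (insCoord j (t, z)) * rieszKer δ i (insCoord j (s - t, w - z))‖ₑ ≤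
      ENNReal.ofReal (C * M * l⁻¹) * (ENNReal.ofReal (l ^ 3 * (G s).toReal * K) + ∫⁻ t, Q s t) := by
    filter_upwards [hGfin] with s hs
    rw [← hPint, ← lintegral_add_left (hPm s), ← lintegral_const_mul' _ _ ENNReal.ofReal_ne_top]
    refine lintegral_mono_ae ?_
    filter_upwards [hfi.prod_right_ae, (measure_eq_zero_iff_ae_notMem.1
      (measure_singleton (μ := (volume : Measure ℝ)) s))] with t ht hts
    have hst : s - t ≠ 0 := sub_ne_zero.2 fun e => hts (by simp [e])
    refine (h f hdiv i j hδ hM hfM hst ht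
      (a := fun w => ‖ψ (insCoord j (s, w))‖ₑ) (hmeas.comp measurable_prodMk_left)).trans ?_
    rw [mul_assoc C, ENNReal.ofReal_mul hC.le, mul_assoc (ENNReal.ofReal C)]
    exact mul_le_mul_right (ofReal_rpow_mul_min_le hs.ne (hm0 t) hM hl hst) _
  refine (lintegral_mono_ae hle).trans ?_
  have hm1 : Measurable fun s => ENNReal.ofReal (l ^ 3 * (G s).toReal * K) := by fun_prop
  rw [lintegral_const_mul' _ _ ENNReal.ofReal_ne_top, lintegral_add_left hm1,
    lintegral_lintegral_swap hQm.aemeasurable]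
  simp_rw [hQint]
  have e1 : ∫⁻ s, ENNReal.ofReal (l ^ 3 * (G s).toReal * K) ≤ ENNReal.ofReal (l ^ 3 * K * I) := by
    rw [ENNReal.ofReal_mul (p := l ^ 3 * K) (by positivity)]
    refine le_trans ?_ (mul_le_mul_right hGI _)
    rw [← lintegral_const_mul' _ _ ENNReal.ofReal_ne_top]
    refine lintegral_mono fun s => ?_
    rw [mul_right_comm, ENNReal.ofReal_mul (p := l ^ 3 * K) (by positivity)]
    exact mul_le_mul_right ENNReal.ofReal_toReal_le _
  have e2 : ∫⁻ t, ENNReal.ofReal (m t / M * K) ≤ ENNReal.ofReal K := by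
    have e : ∀ t, ENNReal.ofReal (m t / M * K) =
        ENNReal.ofReal (K / M) * ENNReal.ofReal (m t) := fun t => by
      rw [← ENNReal.ofReal_mul (by positivity)]; congr 1; field_simp
    simp_rw [e]
    rw [lintegral_const_mul' _ _ ENNReal.ofReal_ne_top]
    refine (mul_le_mul_right hmM _).trans_eq ?_
    rw [← ENNReal.ofReal_mul (by positivity)]; congr 1; field_simp
  refine (mul_le_mul_right (add_le_add e1 e2) _).trans ?_
  rw [← ENNReal.ofReal_add (by positivity) hK, ← ENNReal.ofReal_mul (by positivity)]
  refine ENNReal.ofReal_le_ofReal ?_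
  have : C * (K + 1) * M * l⁻¹ * (l ^ 3 * I + 1) - C * M * l⁻¹ * (l ^ 3 * K * I + K) =
    C * M * l⁻¹ * (l ^ 3 * I + 1) := by ring
  have h0 : 0 ≤ C * M * l⁻¹ * (l ^ 3 * I + 1) := by positivity
  linarith

lemma integral_rieszKer_mul_eq (u : 𝓢(E3, ℝ)) (i j : Fin 3) {δ : ℝ} (hδ : 0 < δ) (s : ℝ)
    (w : Fin 2 → ℝ) :
    ∫ y, rieszKer δ i (insCoord j (s, w) - y) * u y =
      ∫ t, ∫ z, u (insCoord j (t, z)) * rieszKer δ i (insCoord j (s - t, w - z)) := by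
  have hfi := integrable_comp_insCoord j (integrable_rieszKer_mul hδ i u (insCoord j (s, w)))
  rw [← (measurePreserving_insCoord j).integral_comp (insCoord j).measurableEmbedding]
  rw [Measure.volume_eq_prod] at hfi ⊢
  rw [integral_prod _ hfi]
  simp_rw [insCoord_sub, Prod.mk_sub_mk, mul_comm]

lemma exists_abs_integral_rieszKer_le : ∃ C : ℝ, 0 < C ∧
    ∀ (f : Fin 3 → 𝓢(E3, ℝ)), (∀ x, ∑ k, coordDeriv k (f k) x = 0) → ∀ (i j : Fin 3)
      {δ M l I : ℝ}, 0 < δ → 0 < M → 0 < l → 0 ≤ I →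
      ∑ k, ∫⁻ x, ‖f k x‖ₑ ≤ ENNReal.ofReal M → ∀ {ψ : E3 → ℝ}, Continuous ψ →
      ∫⁻ x, ‖ψ x‖ₑ ^ (3 : ℝ) ≤ ENNReal.ofReal I →
      |∫ x, ψ x * ∫ y, rieszKer δ i (x - y) * f j y| ≤ C * M * l⁻¹ * (l ^ 3 * I + 1) := by
  obtain ⟨C, hC, h⟩ := exists_lintegral_slices_le
  refine ⟨C, hC, ?_⟩
  intro f hdiv i j δ M l I hδ hM hl hI hfM ψ hψ hψI
  rw [← ENNReal.ofReal_le_ofReal_iff (by positivity), ← Real.enorm_eq_ofReal_abs]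
  refine le_trans ?_ (h f hdiv i j hδ hM hl hI hfM hψ hψI)
  have hK := continuous_rieszKer hδ i
  have hc1 : Continuous fun p : E3 × E3 => rieszKer δ i (p.1 - p.2) * f j p.2 :=
    (hK.comp (by fun_prop)).mul ((f j).continuous.comp continuous_snd)
  have hm1 : Measurable fun x => ‖∫ y, rieszKer δ i (x - y) * f j y‖ₑ :=
    (StronglyMeasurable.integral_prod_right (f := fun x y => rieszKer δ i (x - y) * f j y)
      hc1.stronglyMeasurable).measurable.enorm
  have hm2 : Measurable fun x => ‖ψ x‖ₑ := hψ.measurable.enorm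
  refine (enorm_integral_le_lintegral_enorm _).trans ?_
  simp_rw [enorm_mul]
  rw [← lintegral_comp_insCoord j (F := fun x => ‖ψ x‖ₑ * ‖∫ y, rieszKer δ i (x - y) * f j y‖ₑ)
    (hm2.mul hm1)]
  refine lintegral_mono fun s => ?_
  have hc2 : Continuous fun p : (ℝ × (Fin 2 → ℝ)) × (Fin 2 → ℝ) =>
      f j (insCoord j (p.1.1, p.2)) * rieszKer δ i (insCoord j (s - p.1.1, p.1.2 - p.2)) :=
    ((f j).continuous.comp ((continuous_insCoord j).comp (by fun_prop))).mul
      (hK.comp ((continuous_insCoord j).comp (by fun_prop)))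
  have hm3 : Measurable fun p : ℝ × (Fin 2 → ℝ) =>
      ‖∫ z, f j (insCoord j (p.1, z)) * rieszKer δ i (insCoord j (s - p.1, p.2 - z))‖ₑ :=
    (StronglyMeasurable.integral_prod_right (f := fun (p : ℝ × (Fin 2 → ℝ)) z =>
      f j (insCoord j (p.1, z)) * rieszKer δ i (insCoord j (s - p.1, p.2 - z)))
      hc2.stronglyMeasurable).measurable.enorm
  have hm4 : Measurable fun w => ‖ψ (insCoord j (s, w))‖ₑ :=
    (hψ.comp ((continuous_insCoord j).comp (by fun_prop))).measurable.enorm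
  have hm5 : Measurable (Function.uncurry fun (t : ℝ) w => ‖ψ (insCoord j (s, w))‖ₑ *
      ‖∫ z, f j (insCoord j (t, z)) * rieszKer δ i (insCoord j (s - t, w - z))‖ₑ) :=
    (hm4.comp measurable_snd).mul hm3
  rw [lintegral_lintegral_swap hm5.aemeasurable]
  refine lintegral_mono fun w => ?_
  rw [lintegral_const_mul' _ _ enorm_ne_top]
  gcongr
  rw [integral_rieszKer_mul_eq (f j) i j hδ]
  exact enorm_integral_le_lintegral_enorm _

/-- The function `sign(h) |h|^{1/2}`. -/
def signedSqrt (h : ℝ) : ℝ := √h - √(-h)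

lemma continuous_signedSqrt : Continuous signedSqrt := by
  unfold signedSqrt; fun_prop

lemma abs_signedSqrt (h : ℝ) : |signedSqrt h| = √|h| := by
  rcases le_total 0 h with hh | hh
  · rw [signedSqrt, Real.sqrt_eq_zero_of_nonpos (by linarith : -h ≤ 0), sub_zero, abs_of_nonneg hh,
      abs_of_nonneg (Real.sqrt_nonneg _)]
  · rw [signedSqrt, Real.sqrt_eq_zero_of_nonpos hh, zero_sub, abs_neg, abs_of_nonpos hh,
      abs_of_nonneg (Real.sqrt_nonneg _)]

lemma signedSqrt_mul_self (h : ℝ) : signedSqrt h * h = |h| ^ (3 / 2 : ℝ) := by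
  rw [show (3 / 2 : ℝ) = 1 / 2 + 1 by norm_num, Real.rpow_add' (abs_nonneg h) (by norm_num),
    ← Real.sqrt_eq_rpow, Real.rpow_one]
  rcases le_total 0 h with hh | hh
  · rw [signedSqrt, Real.sqrt_eq_zero_of_nonpos (by linarith : -h ≤ 0), sub_zero, abs_of_nonneg hh]
  · rw [signedSqrt, Real.sqrt_eq_zero_of_nonpos hh, zero_sub, abs_of_nonpos hh, neg_mul_comm]

lemma enorm_signedSqrt_rpow (h : ℝ) :
    ‖signedSqrt h‖ₑ ^ (3 : ℝ) = ENNReal.ofReal (|h| ^ (3 / 2 : ℝ)) := by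
  rw [Real.enorm_eq_ofReal_abs, abs_signedSqrt, ENNReal.ofReal_rpow_of_nonneg (by positivity)
    (by norm_num), Real.sqrt_eq_rpow, ← Real.rpow_mul (abs_nonneg h)]
  norm_num

lemma integrable_signedSqrt (u : 𝓢(E3, ℝ)) : Integrable fun x => signedSqrt (u x) := by
  obtain ⟨C, hC⟩ : ∃ C : ℝ, ∀ x, (1 + ‖x‖) ^ 8 * ‖u x‖ ≤ C := ⟨_, fun x => by
    simpa using SchwartzMap.one_add_le_sup_seminorm_apply (𝕜 := ℝ) (m := (8, 0)) le_rfl le_rfl u x⟩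
  have hi : Integrable fun x : E3 => √C * (1 + ‖x‖) ^ (-4 : ℝ) :=
    (integrable_one_add_norm (by simp; norm_num)).const_mul _
  refine hi.mono' (continuous_signedSqrt.comp u.continuous).aestronglyMeasurable
    (ae_of_all _ fun x => ?_)
  have hx : 0 < 1 + ‖x‖ := by positivity
  rw [Real.norm_eq_abs, abs_signedSqrt, Real.rpow_neg hx.le, ← div_eq_mul_inv,
    le_div_iff₀ (by positivity)]
  refine Real.le_sqrt_of_sq_le (le_trans (le_of_eq ?_) (hC x))
  rw [mul_pow, Real.sq_sqrt (abs_nonneg _), Real.norm_eq_abs,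
    show (4 : ℝ) = ((4 : ℕ) : ℝ) by norm_num, Real.rpow_natCast]
  ring

lemma exists_lintegral_coordDeriv_rpow_le : ∃ C : ℝ, 0 < C ∧
    ∀ (f : Fin 3 → 𝓢(E3, ℝ)), (∀ x, ∑ k, coordDeriv k (f k) x = 0) → ∀ (i j : Fin 3) {M : ℝ},
      0 < M → ∑ k, ∫⁻ x, ‖f k x‖ₑ ≤ ENNReal.ofReal M →
      ∀ v : 𝓢(E3, ℝ), (∀ y, -∑ k, coordDeriv k (coordDeriv k v) y = f j y) →
      ∫⁻ x, ‖coordDeriv i v x‖ₑ ^ (3 / 2 : ℝ) ≤ ENNReal.ofReal ((C * M) ^ (3 / 2 : ℝ)) := by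
  obtain ⟨C, hC, h⟩ := exists_abs_integral_rieszKer_le
  set c : ℝ := ∫ z, approxDelta 1 z
  have hc : 0 < c := integral_approxDelta_one_pos
  refine ⟨2 * C / c, by positivity, ?_⟩
  intro f hdiv i j M hM hfM v hv
  set u := coordDeriv i v
  set ψ : E3 → ℝ := fun x => signedSqrt (u x) with hψ
  have hψi : Integrable ψ := integrable_signedSqrt u
  have hψc : Continuous ψ := continuous_signedSqrt.comp u.continuous
  have hψu : Integrable fun x => ψ x * u x := by
    obtain ⟨B, hB⟩ : ∃ B : ℝ, ∀ x, ‖u x‖ ≤ B := ⟨_, fun x => u.norm_le_seminorm ℝ x⟩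
    exact hψi.mul_bdd u.continuous.aestronglyMeasurable (ae_of_all _ hB)
  set I : ℝ := ∫ x, ψ x * u x with hI
  have hψe : ∀ x, ψ x * u x = |u x| ^ (3 / 2 : ℝ) := fun x => signedSqrt_mul_self _
  have hI0 : 0 ≤ I := integral_nonneg fun x => by simp only [Pi.zero_apply, hψe]; positivity
  have hIl : ∫⁻ x, ENNReal.ofReal (|u x| ^ (3 / 2 : ℝ)) = ENNReal.ofReal I := by
    rw [hI, ofReal_integral_eq_lintegral_ofReal hψu
      (ae_of_all _ fun x => by simp only [Pi.zero_apply, hψe]; positivity)]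
    simp_rw [hψe]
  have hψI : ∫⁻ x, ‖ψ x‖ₑ ^ (3 : ℝ) ≤ ENNReal.ofReal I := by
    rw [← hIl]
    exact lintegral_mono fun x => (enorm_signedSqrt_rpow _).le
  have hbound : ∀ l : ℝ, 0 < l → c * I ≤ C * M * l⁻¹ * (l ^ 3 * I + 1) := by
    intro l hl
    have ht := (tendsto_integral_rieszKer_laplacian i v hψi).abs
    refine (le_abs_self _).trans (le_of_tendsto ht ?_)
    filter_upwards [self_mem_nhdsWithin] with δ hδ
    refine le_of_eq_of_le ?_ (h f hdiv i j hδ hM hl hI0 hfM hψc hψI)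
    simp_rw [← hv, mul_neg, integral_neg, mul_neg, integral_neg, abs_neg]
  have hfin : I ≤ (2 * C / c * M) ^ (3 / 2 : ℝ) := by
    set N : ℝ := 2 * C / c * M with hN
    have hN0 : 0 < N := by positivity
    have hsq : √N ^ 2 = N := Real.sq_sqrt hN0.le
    have hs0 : 0 < √N := Real.sqrt_pos.2 hN0
    have h1 := hbound (√N)⁻¹ (by positivity)
    have e1 : C * M = c / 2 * N := by rw [hN]; field_simp
    have e2 : (√N)⁻¹⁻¹ * ((√N)⁻¹ ^ 3 * I + 1) = I * N⁻¹ + √N := by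
      have hinv : N⁻¹ = (√N)⁻¹ ^ 2 := by rw [inv_pow, hsq]
      rw [inv_inv, hinv]; field_simp
    rw [mul_assoc, e2, e1] at h1
    have e3 : c / 2 * N * (I * N⁻¹ + √N) = c / 2 * I + c / 2 * (N * √N) := by field_simp
    rw [e3] at h1
    rw [show (3 / 2 : ℝ) = 1 + 1 / 2 by norm_num, Real.rpow_add hN0, Real.rpow_one,
      ← Real.sqrt_eq_rpow]
    have h2 : c / 2 * I ≤ c / 2 * (N * √N) := by linarith
    exact le_of_mul_le_mul_left h2 (by positivity)
  refine le_trans (le_of_eq ?_) (ENNReal.ofReal_le_ofReal hfin)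
  rw [← hIl]
  refine lintegral_congr fun x => ?_
  rw [Real.enorm_eq_ofReal_abs, ENNReal.ofReal_rpow_of_nonneg (abs_nonneg _) (by norm_num)]

/-- The Gagliardo–Nirenberg–Sobolev inequality `‖v‖₃ ≲ ‖∇v‖_{3/2}` for Schwartz functions. -/
lemma SchwartzMap.eLpNorm_three_le_eLpNorm_fderiv {F : Type*} [NormedAddCommGroup F]
    [NormedSpace ℝ F] [FiniteDimensional ℝ F] (v : 𝓢(E3, F)) :
    eLpNorm v 3 volume ≤ SNormLESNormFDerivOfEqConst F (volume : Measure E3) (3 / 2) *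
      eLpNorm (fun x => fderiv ℝ v x) (3 / 2) volume := by
  have h32 : ((3 / 2 : ℝ≥0) : ℝ≥0∞) = 3 / 2 := by
    rw [ENNReal.coe_div (by norm_num)]; rfl
  have h33 : ((3 : ℝ≥0) : ℝ≥0∞) = 3 := rfl
  have h1p : (1 : ℝ≥0∞) ≤ 3 / 2 := by
    rw [← h32]; exact_mod_cast (by rw [le_div_iff₀] <;> norm_num : (1 : ℝ≥0) ≤ 3 / 2)
  set K : ℝ≥0 := SNormLESNormFDerivOfEqConst F (volume : Measure E3) (3 / 2)
  let χ : ContDiffBump (0 : E3) := ⟨1, 2, one_pos, one_lt_two⟩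
  have hχ : ContDiff ℝ 1 χ := χ.contDiff
  obtain ⟨D, hD⟩ : ∃ D : ℝ, ∀ x, ‖fderiv ℝ χ x‖ ≤ D :=
    (hχ.continuous_fderiv one_ne_zero).bounded_above_of_compact_support
      (χ.hasCompactSupport.fderiv ℝ)
  have hD0 : 0 ≤ D := (norm_nonneg _).trans (hD 0)
  have hvs : ContDiff ℝ 1 v := v.smooth 1
  have hvd : Continuous (fderiv ℝ v) := hvs.continuous_fderiv one_ne_zero
  set r : ℕ → ℝ := fun n => ((n : ℝ) + 1)⁻¹ with hr
  have hr0 : ∀ n, 0 < r n := fun n => by positivity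
  have hrlim : Tendsto r atTop (𝓝 0) := by
    simpa [hr] using tendsto_one_div_add_atTop_nhds_zero_nat (𝕜 := ℝ)
  set u : ℕ → E3 → F := fun n x => χ (r n • x) • v x with hu
  have hχr : ∀ n, ContDiff ℝ 1 fun x : E3 => χ (r n • x) := fun n =>
    hχ.comp (contDiff_const_smul (r n))
  have hus : ∀ n, ContDiff ℝ 1 (u n) := fun n => (hχr n).smul hvs
  have huc : ∀ n, HasCompactSupport (u n) := fun n =>
    (χ.hasCompactSupport.comp_smul (hr0 n).ne').smul_right
  have hfd : ∀ n x, ‖fderiv ℝ (u n) x‖ ≤ ‖‖fderiv ℝ v x‖ + (r n * D) * ‖v x‖‖ := by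
    intro n x
    have h1 : HasFDerivAt (fun x : E3 => χ (r n • x))
        ((fderiv ℝ χ (r n • x)).comp (r n • ContinuousLinearMap.id ℝ E3)) x :=
      ((hχ.differentiable one_ne_zero) _).hasFDerivAt.comp x ((hasFDerivAt_id x).const_smul (r n))
    have h2 := h1.smul ((hvs.differentiable one_ne_zero) x).hasFDerivAt
    have h3 : fderiv ℝ (u n) x = _ := h2.fderiv
    rw [h3, Real.norm_of_nonneg (by positivity)]
    refine (norm_add_le _ _).trans (add_le_add ?_ ?_)
    · rw [norm_smul, Real.norm_of_nonneg χ.nonneg]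
      exact mul_le_of_le_one_left (norm_nonneg _) χ.le_one
    · rw [ContinuousLinearMap.norm_smulRight_apply]
      refine mul_le_mul_of_nonneg_right ?_ (norm_nonneg _)
      rw [ContinuousLinearMap.comp_smul, ContinuousLinearMap.comp_id, norm_smul,
        Real.norm_of_nonneg (hr0 n).le]
      exact mul_le_mul_of_nonneg_left (hD _) (hr0 n).le
  set A := eLpNorm (fun x => fderiv ℝ v x) (3 / 2) volume with hA
  set B := eLpNorm v (3 / 2) volume with hB
  have hBfin : B ≠ ∞ := (v.memLp (3 / 2) volume).2.ne
  have hbd : ∀ n, eLpNorm (u n) 3 volume ≤ K * (A + ENNReal.ofReal (r n * D) * B) := by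
    intro n
    have h := eLpNorm_le_eLpNorm_fderiv_of_eq (volume : Measure E3) (hus n) (huc n)
      (p := 3 / 2) (p' := 3) (by rw [le_div_iff₀] <;> norm_num) (by simp) (by simp; norm_num)
    rw [h32, h33] at h
    refine h.trans (mul_le_mul_right ?_ _)
    refine (eLpNorm_mono (hfd n)).trans ?_
    refine (eLpNorm_add_le hvd.norm.aestronglyMeasurable
      (continuous_const.mul v.continuous.norm).aestronglyMeasurable h1p).trans ?_
    refine add_le_add (eLpNorm_norm _).le ?_
    have := eLpNorm_const_smul_le (c := r n * D) (f := fun x => ‖v x‖) (p := 3 / 2)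
      (μ := (volume : Measure E3))
    refine this.trans (le_of_eq ?_)
    rw [eLpNorm_norm, Real.enorm_of_nonneg (by positivity)]
  have hpt : ∀ x, Tendsto (fun n => u n x) atTop (𝓝 (v x)) := by
    intro x
    have h1 : Tendsto (fun n => χ (r n • x)) atTop (𝓝 (χ ((0 : ℝ) • x))) :=
      (hχ.continuous.tendsto _).comp (hrlim.smul_const x)
    have h2 : χ ((0 : ℝ) • x) = 1 := χ.one_of_mem_closedBall (by simp [χ])
    rw [h2] at h1
    simpa using h1.smul_const (v x)
  refine (Lp.eLpNorm_lim_le_liminf_eLpNorm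
    (fun n => (hus n).continuous.aestronglyMeasurable) v (ae_of_all _ hpt)).trans ?_
  have hlim : Tendsto (fun n => (K : ℝ≥0∞) * (A + ENNReal.ofReal (r n * D) * B)) atTop
      (𝓝 (K * (A + ENNReal.ofReal (0 * D) * B))) := by
    refine ENNReal.Tendsto.const_mul (tendsto_const_nhds.add ?_) (Or.inr ENNReal.coe_ne_top)
    exact ENNReal.Tendsto.mul_const (ENNReal.tendsto_ofReal (hrlim.mul_const D)) (Or.inr hBfin)
  refine (liminf_le_liminf (Eventually.of_forall hbd)).trans ?_
  rw [hlim.liminf_eq]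
  simp

/-- The `j`-th component of a Schwartz vector field. -/
def component (j : Fin 3) (v : 𝓢(E3, E3)) : 𝓢(E3, ℝ) :=
  SchwartzMap.postcompCLM (EuclideanSpace.proj j : E3 →L[ℝ] ℝ) v

lemma coordDeriv_sub (k : Fin 3) (a b : 𝓢(E3, ℝ)) :
    coordDeriv k (a - b) = coordDeriv k a - coordDeriv k b := by
  ext x
  have h : (⇑(a - b) : E3 → ℝ) = ⇑a - ⇑b := rfl
  rw [sub_apply, coordDeriv_apply, coordDeriv_apply, coordDeriv_apply, h,
    fderiv_sub a.differentiableAt b.differentiableAt]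
  rfl

lemma fderiv_apply_coord {g : E3 → E3} {x : E3} (hg : DifferentiableAt ℝ g x) (j : Fin 3) (e : E3) :
    fderiv ℝ (fun y => g y j) x e = fderiv ℝ g x e j := by
  have h := ((EuclideanSpace.proj j : E3 →L[ℝ] ℝ).hasFDerivAt.comp x hg.hasFDerivAt).fderiv
  have h' : fderiv ℝ (fun y => g y j) x = _ := h
  rw [h']
  rfl

lemma coordDeriv_component (i j : Fin 3) (v : 𝓢(E3, E3)) (x : E3) :
    coordDeriv i (component j v) x = fderiv ℝ v x (EuclideanSpace.single i 1) j := by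
  rw [coordDeriv_apply]
  exact fderiv_apply_coord v.differentiableAt j _

lemma sum_coordDeriv_component (j : Fin 3) (v : 𝓢(E3, E3)) (x : E3) :
    ∑ k, coordDeriv k (coordDeriv k (component j v)) x = lap v x j := by
  rw [lap, WithLp.ofLp_sum, Finset.sum_apply]
  refine Finset.sum_congr rfl fun k _ => ?_
  have h : (⇑(coordDeriv k (component j v)) : E3 → ℝ) =
      fun y => fderiv ℝ v y (EuclideanSpace.single k 1) j :=
    funext (coordDeriv_component k j v)
  rw [coordDeriv_apply, h]
  refine fderiv_apply_coord (g := fun y => fderiv ℝ v y (EuclideanSpace.single k 1)) ?_ j _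
  exact ((((v.smooth 2).fderiv_right (m := 1) (by norm_num)).clm_apply
    contDiff_const).differentiable one_ne_zero) x

/-- The components of the curl of a Schwartz vector field, as Schwartz functions. -/
def curlComponent (w : 𝓢(E3, E3)) : Fin 3 → 𝓢(E3, ℝ) :=
  ![coordDeriv 1 (component 2 w) - coordDeriv 2 (component 1 w),
    coordDeriv 2 (component 0 w) - coordDeriv 0 (component 2 w),
    coordDeriv 0 (component 1 w) - coordDeriv 1 (component 0 w)]

lemma curlComponent_apply (w : 𝓢(E3, E3)) (k : Fin 3) (x : E3) :
    curlComponent w k x = curl w x k := by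
  fin_cases k <;> simp [curlComponent, curl, pd, coordDeriv_apply] <;> rfl

lemma sum_coordDeriv_curlComponent (w : 𝓢(E3, E3)) (x : E3) :
    ∑ k, coordDeriv k (curlComponent w k) x = 0 := by
  simp only [Fin.sum_univ_three, curlComponent, Matrix.cons_val, coordDeriv_sub,
    sub_apply]
  rw [coordDeriv_comm _ 1 0, coordDeriv_comm _ 2 0, coordDeriv_comm _ 2 1]
  ring

lemma EuclideanSpace.norm_le_sum_norm {ι : Type*} [Fintype ι] (y : EuclideanSpace ℝ ι) :
    ‖y‖ ≤ ∑ j, ‖y j‖ := by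
  rw [EuclideanSpace.norm_eq]
  exact Real.sqrt_le_iff.2 ⟨by positivity,
    Finset.sum_sq_le_sq_sum_of_nonneg fun _ _ => by positivity⟩

lemma norm_le_sum_norm_apply_single (L : E3 →L[ℝ] E3) :
    ‖L‖ ≤ ∑ i, ∑ j, ‖L (EuclideanSpace.single i 1) j‖ := by
  refine L.opNorm_le_bound (by positivity) fun h => ?_
  have hh : h = ∑ i, h i • EuclideanSpace.single i (1 : ℝ) := by
    ext k
    simp [Finset.sum_apply, Pi.single_apply]
  calc ‖L h‖ = ‖∑ i, h i • L (EuclideanSpace.single i 1)‖ := by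
        conv_lhs => rw [hh, map_sum]
        simp_rw [map_smul]
    _ ≤ ∑ i, ‖h i • L (EuclideanSpace.single i 1)‖ := norm_sum_le _ _
    _ ≤ ∑ i, (∑ j, ‖L (EuclideanSpace.single i 1) j‖) * ‖h‖ := by
        refine Finset.sum_le_sum fun i _ => ?_
        rw [norm_smul, mul_comm]
        gcongr
        · exact EuclideanSpace.norm_le_sum_norm _
        · exact PiLp.norm_apply_le h i
    _ = _ := by rw [Finset.sum_mul]

lemma exists_eLpNorm_fderiv_le : ∃ C : ℝ, 0 < C ∧ ∀ w v : 𝓢(E3, E3),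
    (∀ x, -lap v x = curl w x) → ∀ M : ℝ, 0 < M → 3 * eLpNorm (curl w) 1 volume ≤ ENNReal.ofReal M →
      eLpNorm (fun x => fderiv ℝ v x) (3 / 2) volume ≤ ENNReal.ofReal (C * M) := by
  obtain ⟨C, hC, h⟩ := exists_lintegral_coordDeriv_rpow_le
  refine ⟨9 * C, by positivity, fun w v hvw M hM hwM => ?_⟩
  have h32 : (1 : ℝ≥0∞) ≤ 3 / 2 := by
    rw [ENNReal.le_div_iff_mul_le] <;> norm_num
  have h32' : ((3 / 2 : ℝ≥0∞)).toReal = 3 / 2 := by simp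
  have hsum : ∑ k, ∫⁻ x, ‖curlComponent w k x‖ₑ ≤ ENNReal.ofReal M := by
    refine le_trans ?_ hwM
    have : ∀ k ∈ Finset.univ, ∫⁻ x, ‖curlComponent w k x‖ₑ ≤ eLpNorm (curl w) 1 volume := by
      intro k _
      rw [eLpNorm_one_eq_lintegral_enorm]
      refine lintegral_mono fun x => ?_
      rw [curlComponent_apply]
      exact enorm_le_iff_norm_le.2 (PiLp.norm_apply_le _ k)
    simpa using Finset.sum_le_card_nsmul _ _ _ this
  have hp : ∀ i j, eLpNorm (fun x => ‖coordDeriv i (component j v) x‖) (3 / 2) volume ≤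
      ENNReal.ofReal (C * M) := by
    intro i j
    have := h _ (sum_coordDeriv_curlComponent w) i j hM hsum (component j v) fun y => by
      rw [sum_coordDeriv_component, curlComponent_apply, ← hvw]
      rfl
    rw [eLpNorm_norm, eLpNorm_eq_lintegral_rpow_enorm_toReal (by norm_num)
      (ENNReal.div_ne_top (by norm_num) (by norm_num)), h32']
    refine (ENNReal.rpow_le_rpow this (by norm_num)).trans (le_of_eq ?_)
    rw [ENNReal.ofReal_rpow_of_nonneg (by positivity) (by norm_num),
      ← Real.rpow_mul (by positivity)]
    norm_num
  calc eLpNorm (fun x => fderiv ℝ v x) (3 / 2) volume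
      ≤ eLpNorm (∑ p : Fin 3 × Fin 3, fun x => ‖coordDeriv p.1 (component p.2 v) x‖)
          (3 / 2) volume := by
        refine eLpNorm_mono_real fun x => (norm_le_sum_norm_apply_single _).trans (le_of_eq ?_)
        simp only [Finset.sum_apply, Fintype.sum_prod_type, coordDeriv_component]
    _ ≤ ∑ p : Fin 3 × Fin 3, eLpNorm (fun x => ‖coordDeriv p.1 (component p.2 v) x‖)
          (3 / 2) volume :=
        eLpNorm_sum_le (fun p _ => (SchwartzMap.continuous _).norm.aestronglyMeasurable) h32
    _ ≤ ∑ p : Fin 3 × Fin 3, ENNReal.ofReal (C * M) := Finset.sum_le_sum fun p _ => hp _ _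
    _ = ENNReal.ofReal (9 * C * M) := by
        rw [Finset.sum_const, Finset.card_univ, ← ENNReal.ofReal_nsmul]
        congr 1
        simp
        ring

/-- **Bourgain–Brezis estimate, 3D (Proposition 2(a)).**
There is a universal constant `C > 0` such that for all Schwartz vector fields
`ω, v : ℝ³ → ℝ³` satisfying the three-dimensional Biot–Savart relation
`−Δv = ∇ × ω`, one has
`‖v‖_{L³(ℝ³)} + ‖∇v‖_{L^{3/2}(ℝ³)} ≤ C ‖∇ × ω‖_{L¹(ℝ³)}`. -/
theorem bourgain_brezis_biot_savart_3d :
    ∃ C : ℝ, 0 < C ∧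
      ∀ (ω v : SchwartzMap E3 E3),
        (∀ x : E3, -(lap (⇑v) x) = curl (⇑ω) x) →
        eLpNorm (⇑v) 3 volume + eLpNorm (fun x => fderiv ℝ (⇑v) x) (3/2) volume ≤
          ENNReal.ofReal C * eLpNorm (curl (⇑ω)) 1 volume := by
  obtain ⟨C, hC, h⟩ := exists_eLpNorm_fderiv_le
  set K : ℝ≥0 := SNormLESNormFDerivOfEqConst E3 (volume : Measure E3) (3 / 2)
  refine ⟨(K + 1) * C * 3, by positivity, fun ω v hv => ?_⟩
  set G := eLpNorm (curl (⇑ω)) 1 volume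
  set A := eLpNorm (fun x => fderiv ℝ (⇑v) x) (3 / 2) volume
  rcases eq_or_ne G ∞ with hG | hG
  · rw [hG, ENNReal.mul_top (ENNReal.ofReal_pos.2 (by positivity)).ne']
    exact le_top
  have hA : A ≤ ENNReal.ofReal (C * (3 * G.toReal)) := by
    have ht : Tendsto (fun η => ENNReal.ofReal (C * (3 * G.toReal + η))) (𝓝[>] 0)
        (𝓝 (ENNReal.ofReal (C * (3 * G.toReal + 0)))) :=
      (ENNReal.continuous_ofReal.comp (by fun_prop : Continuous fun η : ℝ =>
        C * (3 * G.toReal + η))).continuousWithinAt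
    rw [add_zero] at ht
    refine ge_of_tendsto ht ?_
    filter_upwards [self_mem_nhdsWithin] with η (hη : 0 < η)
    refine h ω v hv _ (by positivity) ?_
    rw [← ENNReal.ofReal_toReal (ENNReal.mul_ne_top ENNReal.ofNat_ne_top hG)]
    refine ENNReal.ofReal_le_ofReal ?_
    simpa using hη.le
  calc eLpNorm (⇑v) 3 volume + A ≤ K * A + A := by
        gcongr
        exact v.eLpNorm_three_le_eLpNorm_fderiv
    _ = ENNReal.ofReal (K + 1) * A := by
        rw [ENNReal.ofReal_add K.coe_nonneg zero_le_one, ENNReal.ofReal_coe_nnreal,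
          ENNReal.ofReal_one, add_mul, one_mul]
    _ ≤ ENNReal.ofReal (K + 1) * ENNReal.ofReal (C * (3 * G.toReal)) := by gcongr
    _ = ENNReal.ofReal ((K + 1) * C * 3) * G := by
        rw [← ENNReal.ofReal_mul (by positivity)]
        conv_rhs => rw [← ENNReal.ofReal_toReal hG, ← ENNReal.ofReal_mul (by positivity)]
        congr 1
        ring

end
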